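/- arXiv:1002.0823 — 2 statements merged into one kernel-verified Lean document; each statement's English description precedes it below -/
import Mathlib

section
/- Let (a_n)_{n≥0} be a bounded sequence of complex numbers and f(z) = Σ_{n=0}^∞ a_n z^n the analytic function it defines on the open unit disc 𝔻. Suppose I is a nonempty open arc of the unit circle ∂𝔻 such that f has an analytic continuation to a neighborhood of I, i.e., there is an open set U ⊂ ℂ containing I and a function g analytic on 𝔻 ∪ U with g = f on 𝔻. Then every right limit of (a_n) is reflectionless on I. -/
open Filter Metric Set

/-- `b : ℤ → ℂ` is a right limit of `a : ℕ → ℂ`. -/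
def IsRightLimit (a : ℕ → ℂ) (b : ℤ → ℂ) : Prop :=
  ∃ n : ℕ → ℕ, StrictMono n ∧
    ∀ k : ℤ, Tendsto (fun j => a (k + n j).toNat) atTop (nhds (b k))

/-- `f_+` for a two-sided sequence. -/
noncomputable def fPlus (b : ℤ → ℂ) (z : ℂ) : ℂ := ∑' n : ℕ, b n * z ^ n

/-- `f_-` for a two-sided sequence. -/
noncomputable def fMinus (b : ℤ → ℂ) (z : ℂ) : ℂ :=
  ∑' n : ℕ, b (-(n : ℤ) - 1) * z ^ (-(n : ℤ) - 1)

/-- The open arc `{e^{iθ} : α < θ < β}` of the unit circle. -/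
def arc (α β : ℝ) : Set ℂ := {z | ∃ θ ∈ Set.Ioo α β, z = Complex.exp (θ * Complex.I)}

/-- The two-sided sequence `b` is reflectionless on the arc `I`. -/
def Reflectionless (b : ℤ → ℂ) (I : Set ℂ) : Prop :=
  ∃ g : ℂ → ℂ,
    DifferentiableOn ℂ g ((Metric.sphere (0 : ℂ) 1 \ I)ᶜ) ∧
    (∀ z ∈ Metric.ball (0 : ℂ) 1, g z = fPlus b z) ∧
    (∀ z : ℂ, 1 < ‖z‖ → g z = - fMinus b z)


lemma core_circle (F : ℕ → ℂ → ℂ) (K : ℝ)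
    (hd : ∀ j, DifferentiableOn ℂ (F j) (closedBall 0 1))
    (hb : ∀ j w, ‖w‖ = 1 → ‖F j w‖ ≤ K)
    (hc : ∀ w : ℂ, ‖w‖ = 1 → ∃ l, Tendsto (fun j => F j w) atTop (nhds l)) :
    ∃ G : ℂ → ℂ, DifferentiableOn ℂ G (ball 0 1) ∧
      ∀ w ∈ ball (0 : ℂ) 1, Tendsto (fun j => F j w) atTop (nhds (G w)) := by
  classical
  let L : ℂ → ℂ := fun w => limUnder atTop (fun j => F j w)
  have hL : ∀ w : ℂ, ‖w‖ = 1 → Tendsto (fun j => F j w) atTop (nhds (L w)) :=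
    fun w hw => tendsto_nhds_limUnder (hc w hw)
  have hcm : ∀ θ : ℝ, ‖circleMap 0 1 θ‖ = 1 := fun θ => by simp
  have hcont : ∀ j, Continuous (fun θ : ℝ => F j (circleMap 0 1 θ)) := fun j =>
    (hd j).continuousOn.comp_continuous (continuous_circleMap 0 1)
      (fun θ => by simp)
  have hLb : ∀ w : ℂ, ‖w‖ = 1 → ‖L w‖ ≤ K := fun w hw =>
    le_of_tendsto (hL w hw).norm (Eventually.of_forall fun j => hb j w hw)
  have hmeas : ∀ μ : MeasureTheory.Measure ℝ,
      MeasureTheory.AEStronglyMeasurable (fun θ : ℝ => L (circleMap 0 1 θ)) μ := fun μ =>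
    aestronglyMeasurable_of_tendsto_ae atTop
      (fun j => (hcont j).aestronglyMeasurable)
      (Eventually.of_forall fun θ => hL _ (hcm θ))
  have hLi : CircleIntegrable L 0 ((1 : NNReal) : ℝ) := by
    have : IntervalIntegrable (fun _ : ℝ => K) MeasureTheory.volume 0 (2 * Real.pi) :=
      intervalIntegrable_const
    exact this.mono_fun' (by simpa using hmeas _)
      (Eventually.of_forall fun θ => by simpa using hLb _ (hcm θ))
  have hps := hasFPowerSeriesOn_cauchy_integral hLi one_pos
  refine ⟨fun w => (2 * (Real.pi : ℂ) * Complex.I)⁻¹ • ∮ (z : ℂ) in C(0, 1), (z - w)⁻¹ • L z,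
    ?_, ?_⟩
  · have := hps.differentiableOn
    rw [show Metric.eball (0 : ℂ) ((1 : NNReal) : ENNReal) = ball 0 1 by
      rw [Metric.eball_coe]; rfl] at this
    simpa using this
  · intro w hw
    have heq : ∀ j, F j w =
        (2 * (Real.pi : ℂ) * Complex.I)⁻¹ • ∮ (z : ℂ) in C(0, 1), (z - w)⁻¹ • F j z := by
      intro j
      rw [(hd j).circleIntegral_sub_inv_smul hw, smul_smul, inv_mul_cancel₀, one_smul]
      exact Complex.two_pi_I_ne_zero
    have hw1 : ‖w‖ < 1 := by simpa using hw
    have hne : ∀ θ : ℝ, circleMap 0 1 θ - w ≠ 0 := by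
      intro θ h
      have := hcm θ
      rw [sub_eq_zero.1 h] at this
      linarith
    have hlow : ∀ θ : ℝ, 1 - ‖w‖ ≤ ‖circleMap 0 1 θ - w‖ := by
      intro θ
      have := norm_sub_norm_le (circleMap 0 1 θ) w
      rwa [hcm θ] at this
    simp_rw [heq]
    refine Tendsto.const_smul ?_ _
    unfold circleIntegral
    refine intervalIntegral.tendsto_integral_filter_of_dominated_convergence
      (fun _ => (1 - ‖w‖)⁻¹ * K) ?_ ?_ intervalIntegrable_const ?_
    · refine Eventually.of_forall fun j => Continuous.aestronglyMeasurable ?_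
      simp only [deriv_circleMap]
      have h1 := continuous_circleMap 0 1
      exact (h1.mul continuous_const).smul
        (((h1.sub continuous_const).inv₀ hne).smul (hcont j))
    · refine Eventually.of_forall fun j => Eventually.of_forall fun θ _ => ?_
      simp only [deriv_circleMap, norm_smul, norm_mul, hcm, Complex.norm_I, norm_inv, one_mul]
      have h1 : 0 < 1 - ‖w‖ := by linarith
      gcongr
      · exact hlow θ
      · exact hb j _ (hcm θ)
    · refine Eventually.of_forall fun θ _ => ?_
      exact ((hL _ (hcm θ)).const_smul _).const_smul _

lemma core_local (z0 : ℂ) (hz0 : ‖z0‖ = 1) (r : ℝ) (hr : 0 < r) (hr1 : r ≤ 1 / 2)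
    (h : ℕ → ℂ → ℂ) (K : ℝ)
    (hd : ∀ j, DifferentiableOn ℂ (h j) (closedBall z0 r))
    (hb : ∀ j, ∀ z ∈ closedBall z0 r, |‖z‖ ^ 2 - 1| * ‖h j z‖ ≤ K)
    (hc : ∀ z ∈ closedBall z0 r, ‖z‖ ≠ 1 → ∃ l, Tendsto (fun j => h j z) atTop (nhds l)) :
    ∃ G : ℂ → ℂ, DifferentiableOn ℂ G (ball z0 (r / 2)) ∧
      ∀ z ∈ ball z0 (r / 2), Tendsto (fun j => h j z) atTop (nhds (G z)) := by
  have hz0' : z0 ≠ 0 := by rw [← norm_ne_zero_iff, hz0]; norm_num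
  have hrc : (r : ℂ) ≠ 0 := by exact_mod_cast hr.ne'
  let P : ℂ → ℂ := fun w => w ^ 2 + r * w + 1
  let φ : ℂ → ℂ := fun w => z0 * (1 + r * w)
  have hφ : ∀ w, ‖w‖ ≤ 1 → φ w ∈ closedBall z0 r := by
    intro w hw
    rw [mem_closedBall, dist_eq_norm, show φ w - z0 = z0 * (r * w) by simp only [φ]; ring,
      norm_mul, norm_mul, hz0, Complex.norm_real, Real.norm_of_nonneg hr.le]
    nlinarith
  have hP : ∀ w : ℂ, ‖w‖ = 1 → r * ‖P w‖ = |‖φ w‖ ^ 2 - 1| := by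
    intro w hw
    have h1 : (((‖φ w‖ ^ 2 - 1 : ℝ)) : ℂ) * w = r * P w := by
      have hww : w * (starRingEnd ℂ) w = 1 := by
        rw [Complex.mul_conj, Complex.normSq_eq_norm_sq, hw]; norm_num
      have hzz : z0 * (starRingEnd ℂ) z0 = 1 := by
        rw [Complex.mul_conj, Complex.normSq_eq_norm_sq, hz0]; norm_num
      have : (((‖φ w‖ ^ 2 : ℝ)) : ℂ) = φ w * (starRingEnd ℂ) (φ w) := by
        rw [Complex.mul_conj, Complex.normSq_eq_norm_sq]
      rw [Complex.ofReal_sub, this]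
      simp only [φ, P, map_mul, map_add, map_one, Complex.conj_ofReal, Complex.ofReal_one]
      linear_combination ((1 + r * w) * (1 + r * (starRingEnd ℂ) w) * w) * hzz
        + (r ^ 2 * w + r) * hww
    have h2 := congrArg norm h1
    rw [norm_mul (_ : ℂ) w, norm_mul (r : ℂ), hw, Complex.norm_real, Complex.norm_real,
      Real.norm_of_nonneg hr.le, Real.norm_eq_abs] at h2
    linarith
  obtain ⟨G, hG, hGt⟩ := core_circle (fun j w => P w * h j (φ w)) (K / r)
    (by
      intro j
      refine DifferentiableOn.mul (by fun_prop) ?_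
      exact (hd j).comp (by fun_prop) (fun w hw => hφ w (by simpa using hw)))
    (by
      intro j w hw
      rw [le_div_iff₀ hr, norm_mul]
      have := hb j _ (hφ w hw.le)
      rw [← hP w hw] at this
      linarith)
    (by
      intro w hw
      by_cases hn : ‖φ w‖ = 1
      · have := hP w hw
        rw [hn] at this
        have hP0 : P w = 0 := by
          have : r * ‖P w‖ = 0 := by rw [this]; norm_num
          rcases mul_eq_zero.1 this with h | h
          · exact absurd h hr.ne'
          · exact norm_eq_zero.1 h
        exact ⟨0, by simp [hP0]⟩
      · obtain ⟨l, hl⟩ := hc _ (hφ w hw.le) hn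
        exact ⟨P w * l, hl.const_mul _⟩)
  let ψ : ℂ → ℂ := fun z => (z - z0) / (r * z0)
  have hψ : ∀ z ∈ ball z0 (r / 2), ‖ψ z‖ < 1 / 2 := by
    intro z hz
    rw [mem_ball, dist_eq_norm] at hz
    simp only [ψ]
    rw [norm_div, norm_mul, hz0, Complex.norm_real, Real.norm_of_nonneg hr.le, mul_one,
      div_lt_iff₀ hr]
    linarith
  have hφψ : ∀ z, φ (ψ z) = z := by
    intro z
    simp only [φ, ψ]
    field_simp
    ring
  have hPne : ∀ w : ℂ, ‖w‖ < 1 / 2 → P w ≠ 0 := by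
    intro w hw h0
    have h1 : (1 : ℂ) = - (w ^ 2 + r * w) := by
      simp only [P] at h0
      linear_combination h0
    have h2 : (1 : ℝ) ≤ ‖w‖ ^ 2 + r * ‖w‖ := by
      calc (1 : ℝ) = ‖(1 : ℂ)‖ := by simp
        _ = ‖w ^ 2 + r * w‖ := by rw [h1, norm_neg]
        _ ≤ ‖w ^ 2‖ + ‖(r : ℂ) * w‖ := norm_add_le _ _
        _ = _ := by rw [norm_pow, norm_mul, Complex.norm_real, Real.norm_of_nonneg hr.le]
    nlinarith [norm_nonneg w]
  have hψb : MapsTo ψ (ball z0 (r / 2)) (ball 0 1) := fun z hz => by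
    have := hψ z hz
    rw [mem_ball_zero_iff]; linarith
  refine ⟨fun z => G (ψ z) / P (ψ z), ?_, ?_⟩
  · refine DifferentiableOn.div (hG.comp (by fun_prop) hψb) (by fun_prop) ?_
    exact fun z hz => hPne _ (hψ z hz)
  · intro z hz
    have h1 := (hGt _ (hψb hz)).div_const (P (ψ z))
    refine h1.congr fun j => ?_
    rw [hφψ, mul_div_cancel_left₀ _ (hPne _ (hψ z hz))]

lemma ps_bound (c : ℕ → ℂ) (C : ℝ) (hc : ∀ n, ‖c n‖ ≤ C) (z : ℂ) (hz : ‖z‖ < 1) :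
    ‖∑' n, c n * z ^ n‖ ≤ C * (1 - ‖z‖)⁻¹ := by
  refine tsum_of_norm_bounded ((hasSum_geometric_of_lt_one (norm_nonneg z) hz).mul_left C) ?_
  intro n
  rw [norm_mul, norm_pow]
  gcongr
  exact hc n

lemma ps_summable (c : ℕ → ℂ) (C : ℝ) (hc : ∀ n, ‖c n‖ ≤ C) (z : ℂ) (hz : ‖z‖ < 1) :
    Summable fun n => c n * z ^ n := by
  refine Summable.of_norm_bounded ((summable_geometric_of_lt_one (norm_nonneg z) hz).mul_left C) ?_
  intro n
  rw [norm_mul, norm_pow]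
  gcongr
  exact hc n

lemma ps_tendsto (c : ℕ → ℕ → ℂ) (d : ℕ → ℂ) (C : ℝ) (hc : ∀ j n, ‖c j n‖ ≤ C)
    (hd : ∀ n, Tendsto (fun j => c j n) atTop (nhds (d n))) (z : ℂ) (hz : ‖z‖ < 1) :
    Tendsto (fun j => ∑' n, c j n * z ^ n) atTop (nhds (∑' n, d n * z ^ n)) := by
  refine tendsto_tsum_of_dominated_convergence
    ((summable_geometric_of_lt_one (norm_nonneg z) hz).mul_left C)
    (fun n => (hd n).mul_const _) (Eventually.of_forall fun j n => ?_)
  rw [norm_mul, norm_pow]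
  gcongr
  exact hc j n

lemma ps_diff (c : ℕ → ℂ) (C : ℝ) (hc : ∀ n, ‖c n‖ ≤ C) (z : ℂ) (hz : ‖z‖ < 1) :
    DifferentiableAt ℂ (fun z => ∑' n, c n * z ^ n) z := by
  obtain ⟨ρ, h1, h2⟩ := exists_between hz
  have hρ : 0 ≤ ρ := (norm_nonneg z).trans h1.le
  have : DifferentiableOn ℂ (fun z : ℂ => ∑' n, c n * z ^ n) (ball 0 ρ) := by
    refine Complex.differentiableOn_tsum_of_summable_norm
      ((summable_geometric_of_lt_one hρ h2).mul_left C) (fun n => by fun_prop) isOpen_ball ?_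
    intro n w hw
    rw [mem_ball_zero_iff] at hw
    rw [norm_mul, norm_pow]
    have := (norm_nonneg _).trans (hc n)
    gcongr
    exact hc n
  exact this.differentiableAt (isOpen_ball.mem_nhds (by simpa using h1))

lemma fMinus_eq (b : ℤ → ℂ) (z : ℂ) :
    fMinus b z = z⁻¹ * ∑' n : ℕ, b (-(n : ℤ) - 1) * z⁻¹ ^ n := by
  rw [fMinus, ← tsum_mul_left]
  refine tsum_congr fun n => ?_
  rw [show (-(n : ℤ) - 1) = -((n + 1 : ℕ) : ℤ) by push_cast; ring, zpow_neg, zpow_natCast,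
    pow_succ, mul_inv, inv_pow]
  ring

/-- the shifted function -/
noncomputable def hN (a : ℕ → ℂ) (g : ℂ → ℂ) (N : ℕ) (z : ℂ) : ℂ :=
  (g z - ∑ n ∈ Finset.range N, a n * z ^ n) / z ^ N

lemma hN_inside (a : ℕ → ℂ) (C : ℝ) (hC : ∀ n, ‖a n‖ ≤ C) (g : ℂ → ℂ) (N : ℕ) (z : ℂ)
    (hz : ‖z‖ < 1) (hz0 : z ≠ 0) (hg : g z = ∑' n : ℕ, a n * z ^ n) :
    hN a g N z = ∑' n : ℕ, a (n + N) * z ^ n := by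
  rw [hN, hg, ← (ps_summable a C hC z hz).sum_add_tsum_nat_add N, add_sub_cancel_left,
    div_eq_iff (pow_ne_zero _ hz0), ← tsum_mul_right]
  refine tsum_congr fun n => ?_
  rw [pow_add]; ring

lemma hN_outside (a : ℕ → ℂ) (g : ℂ → ℂ) (N : ℕ) (z : ℂ) (hz0 : z ≠ 0) :
    hN a g N z = g z * z⁻¹ ^ N
      - z⁻¹ * ∑' n : ℕ, (if n < N then a (N - 1 - n) else 0) * z⁻¹ ^ n := by
  rw [tsum_eq_sum (s := Finset.range N) (by
    intro n hn
    rw [if_neg (by simpa using hn), zero_mul]), hN, sub_div, ← Finset.sum_range_reflect,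
    Finset.mul_sum, Finset.sum_div, inv_pow, div_eq_mul_inv]
  congr 1
  refine Finset.sum_congr rfl fun n hn => ?_
  have hn : n < N := by simpa using hn
  rw [if_pos hn]
  obtain ⟨m, rfl⟩ := Nat.exists_eq_add_of_lt hn
  rw [show n + m + 1 - 1 - n = m by omega, inv_pow]
  field_simp
  ring

theorem stmt0 (a : ℕ → ℂ) (C : ℝ) (hC : ∀ n, ‖a n‖ ≤ C)
    (f : ℂ → ℂ) (hf : ∀ z ∈ Metric.ball (0 : ℂ) 1, f z = ∑' n : ℕ, a n * z ^ n)
    (α β : ℝ) (hαβ : α < β)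
    (hcont : ∃ U : Set ℂ, IsOpen U ∧ arc α β ⊆ U ∧
      ∃ g : ℂ → ℂ, DifferentiableOn ℂ g (Metric.ball (0 : ℂ) 1 ∪ U) ∧
        ∀ z ∈ Metric.ball (0 : ℂ) 1, g z = f z) :
    ∀ b : ℤ → ℂ, IsRightLimit a b → Reflectionless b (arc α β) := by
  classical
  rintro b ⟨n, hn, hlim⟩
  obtain ⟨U, hU, hIU, g, hg, hgf⟩ := hcont
  have hC0 : 0 ≤ C := (norm_nonneg _).trans (hC 0)
  have hgz : ∀ z : ℂ, ‖z‖ < 1 → g z = ∑' n : ℕ, a n * z ^ n := fun z hz => by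
    rw [hgf z (by simpa using hz), hf z (by simpa using hz)]
  have hbC : ∀ k, ‖b k‖ ≤ C := fun k =>
    le_of_tendsto (hlim k).norm (Eventually.of_forall fun j => hC _)
  have hntop : Tendsto n atTop atTop := hn.tendsto_atTop
  have hin : ∀ z : ℂ, ‖z‖ < 1 → z ≠ 0 →
      Tendsto (fun j => hN a g (n j) z) atTop (nhds (fPlus b z)) := by
    intro z hz hz0
    simp_rw [fun j => hN_inside a C hC g (n j) z hz hz0 (hgz z hz)]
    refine ps_tendsto (fun j k => a (k + n j)) (fun k => b k) C (fun j k => hC _) ?_ z hz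
    intro k
    refine (hlim k).congr fun j => ?_
    congr 1
  have hcC : ∀ j k : ℕ, ‖(if k < j then a (j - 1 - k) else 0)‖ ≤ C := by
    intro j k
    split_ifs
    · exact hC _
    · simpa using hC0
  have hout : ∀ z : ℂ, 1 < ‖z‖ →
      Tendsto (fun j => hN a g (n j) z) atTop (nhds (- fMinus b z)) := by
    intro z hz
    have hz0 : z ≠ 0 := norm_pos_iff.1 (by linarith)
    have hzi : ‖z⁻¹‖ < 1 := by rw [norm_inv]; exact inv_lt_one_of_one_lt₀ hz
    simp_rw [fun j => hN_outside a g (n j) z hz0]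
    rw [fMinus_eq, ← zero_sub]
    refine Tendsto.sub ?_ (Tendsto.const_mul _ ?_)
    · simpa using ((tendsto_pow_atTop_nhds_zero_of_norm_lt_one hzi).comp hntop).const_mul (g z)
    · refine ps_tendsto (fun j k => if k < n j then a (n j - 1 - k) else 0)
        (fun k => b (-(k : ℤ) - 1)) C (fun j k => hcC _ _) ?_ _ hzi
      intro k
      refine (hlim _).congr' ?_
      filter_upwards [hntop.eventually_gt_atTop k] with j hj
      rw [if_pos hj]
      congr 1
      omega
  -- local statement on the arc
  have hloc : ∀ z0 ∈ arc α β, ∃ ε > 0, (∀ z ∈ ball z0 ε, z ≠ 0) ∧ ∃ G : ℂ → ℂ,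
      DifferentiableOn ℂ G (ball z0 ε) ∧
      ∀ z ∈ ball z0 ε, Tendsto (fun j => hN a g (n j) z) atTop (nhds (G z)) := by
    intro z0 hz0
    have hz0n : ‖z0‖ = 1 := by
      obtain ⟨θ, -, rfl⟩ := hz0
      exact Complex.norm_exp_ofReal_mul_I θ
    obtain ⟨s, hs, hsU⟩ := Metric.nhds_basis_closedBall.mem_iff.1 (hU.mem_nhds (hIU hz0))
    set r := min s (1 / 2) with hrdef
    have hr : 0 < r := by positivity
    have hr1 : r ≤ 1 / 2 := min_le_right _ _
    have hrU : closedBall z0 r ⊆ U := (closedBall_subset_closedBall (min_le_left _ _)).trans hsU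
    have hlow : ∀ z ∈ closedBall z0 r, 1 / 2 ≤ ‖z‖ ∧ ‖z‖ ≤ 3 / 2 := by
      intro z hz
      rw [mem_closedBall, dist_eq_norm] at hz
      have h1 := norm_sub_norm_le z z0
      have h2 := norm_sub_norm_le z0 z
      rw [norm_sub_rev] at h2
      constructor <;> linarith
    have hne : ∀ z ∈ closedBall z0 r, z ≠ 0 := fun z hz =>
      norm_pos_iff.1 (by linarith [(hlow z hz).1])
    have hgd : DifferentiableOn ℂ g (closedBall z0 r) :=
      hg.mono (hrU.trans subset_union_right)
    obtain ⟨M, hM⟩ := (isCompact_closedBall z0 r).exists_bound_of_continuousOn hgd.continuousOn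
    have hM0 : 0 ≤ M := (norm_nonneg _).trans (hM z0 (mem_closedBall_self hr.le))
    obtain ⟨G, hG, hGt⟩ := core_local z0 hz0n r hr hr1 (fun j => hN a g (n j)) (3 * M + 3 * C)
      (by
        intro j
        unfold hN
        refine DifferentiableOn.div (hgd.sub (by fun_prop)) (by fun_prop) ?_
        exact fun z hz => pow_ne_zero _ (hne z hz))
      (by
        intro j z hz
        obtain ⟨hl, hu⟩ := hlow z hz
        rcases lt_trichotomy ‖z‖ 1 with h | h | h
        · rw [hN_inside a C hC g (n j) z h (hne z hz) (hgz z h)]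
          have h1 := ps_bound (fun k => a (k + n j)) C (fun k => hC _) z h
          have h2 : 0 < 1 - ‖z‖ := by linarith
          rw [show |‖z‖ ^ 2 - 1| = (1 - ‖z‖) * (1 + ‖z‖) by
            rw [abs_of_nonpos (by nlinarith)]; ring]
          rw [← div_eq_mul_inv, le_div_iff₀ h2] at h1
          nlinarith
        · rw [h]; norm_num; positivity
        · have hzi : ‖z⁻¹‖ < 1 := by rw [norm_inv]; exact inv_lt_one_of_one_lt₀ h
          have h1 := ps_bound _ C (hcC (n j)) z⁻¹ hzi
          have h2 : 0 < ‖z‖ - 1 := by linarith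
          have h3 : ‖hN a g (n j) z‖ ≤ M + C / (‖z‖ - 1) := by
            rw [hN_outside a g (n j) z (hne z hz)]
            refine (norm_sub_le _ _).trans (add_le_add ?_ ?_)
            · rw [norm_mul, norm_pow]
              have := pow_le_one₀ (n := n j) (norm_nonneg _) hzi.le
              nlinarith [hM z hz, norm_nonneg (g z)]
            · rw [norm_mul]
              refine (mul_le_mul_of_nonneg_left h1 (norm_nonneg _)).trans (le_of_eq ?_)
              rw [norm_inv] at hzi ⊢
              have h4 : ‖z‖ ≠ 0 := by linarith
              have h5 : 1 - ‖z‖⁻¹ = (‖z‖ - 1) / ‖z‖ := by field_simp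
              rw [h5]
              field_simp
          have h4 : (‖z‖ - 1) * ‖hN a g (n j) z‖ ≤ M * (‖z‖ - 1) + C := by
            have := mul_le_mul_of_nonneg_left h3 h2.le
            rwa [mul_add, mul_div_cancel₀ _ h2.ne', mul_comm _ M] at this
          rw [show |‖z‖ ^ 2 - 1| = (‖z‖ + 1) * (‖z‖ - 1) by
            rw [abs_of_nonneg (by nlinarith)]; ring, mul_assoc]
          calc _ ≤ (‖z‖ + 1) * (M * (‖z‖ - 1) + C) := by gcongr
            _ ≤ 3 * (M * 1 + C) := by gcongr <;> linarith
            _ = _ := by ring)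
      (by
        intro z hz h
        rcases lt_or_gt_of_ne h with h | h
        · exact ⟨_, hin z h (hne z hz)⟩
        · exact ⟨_, hout z h⟩)
    refine ⟨r / 2, by positivity, fun z hz => hne z ?_, G, hG, hGt⟩
    exact ball_subset_closedBall (ball_subset_ball (by linarith) hz)
  let R : ℂ → ℂ := fun z => if ‖z‖ < 1 then fPlus b z else if 1 < ‖z‖ then - fMinus b z
    else limUnder atTop (fun j => hN a g (n j) z)
  have hRin : ∀ z : ℂ, ‖z‖ < 1 → R z = fPlus b z := fun z hz => if_pos hz
  have hRout : ∀ z : ℂ, 1 < ‖z‖ → R z = - fMinus b z := fun z hz => by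
    simp only [R]; rw [if_neg (by linarith), if_pos hz]
  refine ⟨R, ?_, fun z hz => hRin z (by simpa using hz), hRout⟩
  intro z hz
  refine DifferentiableAt.differentiableWithinAt ?_
  rcases lt_trichotomy ‖z‖ 1 with h | h | h
  · refine (ps_diff (fun k => b k) C (fun k => hbC _) z h).congr_of_eventuallyEq ?_
    filter_upwards [continuous_norm.continuousAt.eventually_lt continuousAt_const h] with w hw
    exact hRin w hw
  · have hzI : z ∈ arc α β := by
      by_contra hcon
      exact hz ⟨by simpa using h, hcon⟩
    obtain ⟨ε, hε, hne, G, hG, hGt⟩ := hloc z hzI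
    have hnh := ball_mem_nhds z hε
    refine (hG.differentiableAt hnh).congr_of_eventuallyEq ?_
    filter_upwards [hnh] with w hw
    have ht := hGt w hw
    rcases lt_trichotomy ‖w‖ 1 with h | h | h
    · rw [hRin w h]
      exact tendsto_nhds_unique (hin w h (hne w hw)) ht
    · simp only [R]
      rw [if_neg (by linarith), if_neg (by linarith)]
      exact ht.limUnder_eq
    · rw [hRout w h]
      exact tendsto_nhds_unique (hout w h) ht
  · have hz0 : z ≠ 0 := norm_pos_iff.1 (by linarith)
    have hzi : ‖z⁻¹‖ < 1 := by rw [norm_inv]; exact inv_lt_one_of_one_lt₀ h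
    have hd := ps_diff (fun k => b (-(k : ℤ) - 1)) C (fun k => hbC _) z⁻¹ hzi
    have hi : DifferentiableAt ℂ (fun z : ℂ => z⁻¹) z := differentiableAt_inv hz0
    have hd2 := (hi.mul (DifferentiableAt.comp z hd hi)).neg
    refine hd2.congr_of_eventuallyEq ?_
    filter_upwards [continuousAt_const.eventually_lt continuous_norm.continuousAt h] with w hw
    rw [hRout w hw, fMinus_eq]
    rfl
end

section
/- Let (a_n)_{n≥0} be a bounded sequence of complex numbers and f(z) = Σ_{n=0}^∞ a_n z^n the analytic function it defines on the open unit disc 𝔻. Suppose I = {e^{iθ} : α < θ < β} is a nonempty open arc of the unit circle such that sup_{0<r<1} ∫_α^β |f(re^{iθ})| dθ/(2π) < ∞. Then every right limit of (a_n) is reflectionless on I. -/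
open Filter Metric Set MeasureTheory

/-- `f` has a strong natural boundary on the unit circle. -/
def StrongNaturalBoundary (f : ℂ → ℂ) : Prop :=
  ∀ α β : ℝ, α < β →
    ¬ ∃ M : ℝ, ∀ r : ℝ, 0 < r → r < 1 →
      (∫ θ in α..β, ‖f (r * Complex.exp (θ * Complex.I))‖) / (2 * Real.pi) ≤ M

/-- `f` has a (classical) natural boundary on the unit circle. -/
def NaturalBoundary (f : ℂ → ℂ) : Prop :=
  ¬ ∃ z₀ : ℂ, ‖z₀‖ = 1 ∧ ∃ δ > (0 : ℝ), ∃ g : ℂ → ℂ,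
    DifferentiableOn ℂ g (Metric.ball (0 : ℂ) 1 ∪ Metric.ball z₀ δ) ∧
    ∀ z ∈ Metric.ball (0 : ℂ) 1, g z = f z


theorem raj_closed {H : Type*} [SeminormedAddCommGroup H] (A : ℕ → H → ℂ) (B : ℝ)
    (hA : ∀ n x y, ‖A n x - A n y‖ ≤ B * ‖x - y‖) :
    IsClosed {x | Tendsto (fun n => A n x) atTop (nhds 0)} := by
  rw [← isSeqClosed_iff_isClosed]
  intro x y hx hxy
  simp only [mem_ofPred_eq] at hx ⊢
  rw [Metric.tendsto_atTop]
  intro ε hε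
  have h1 : Tendsto (fun n => B * ‖y - x n‖) atTop (nhds (B * 0)) := by
    refine Tendsto.const_mul B ?_
    have := (tendsto_const_nhds (x := y)).sub hxy
    simpa using this.norm
  rw [mul_zero] at h1
  obtain ⟨k, hk⟩ := (h1.eventually (gt_mem_nhds (half_pos hε))).exists
  obtain ⟨N, hN⟩ := Metric.tendsto_atTop.1 (hx k) (ε/2) (half_pos hε)
  refine ⟨N, fun n hn => ?_⟩
  have h2 := hN n hn
  rw [dist_zero_right] at h2 ⊢
  have h3 := hA n y (x k)
  have h4 : A n y = (A n y - A n (x k)) + A n (x k) := by ring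
  rw [h4]
  calc _ ≤ _ := norm_add_le _ _
    _ < ε := by linarith

theorem raj_hilbert {H : Type*} [NormedAddCommGroup H] [InnerProductSpace ℂ H] [CompleteSpace H]
    (T : H →ₗᵢ[ℂ] H) (g : H)
    (hg : Tendsto (fun n : ℕ => inner ℂ g (T^[n] g)) atTop (nhds 0)) (u : H) :
    Tendsto (fun n : ℕ => inner ℂ (T^[n] g) u) atTop (nhds 0) := by
  have hin : ∀ (n : ℕ) x y, inner ℂ (T^[n] x) (T^[n] y) = inner ℂ x y := by
    intro n
    induction n with
    | zero => intro x y; rfl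
    | succ n ih => intro x y; rw [Function.iterate_succ_apply, Function.iterate_succ_apply, ih]; simp
  have hno : ∀ n : ℕ, ‖T^[n] g‖ = ‖g‖ := by
    intro n
    have := hin n g g
    rw [inner_self_eq_norm_sq_to_K, inner_self_eq_norm_sq_to_K] at this
    have h2 : ‖T^[n] g‖ ^ 2 = ‖g‖ ^ 2 := by exact_mod_cast this
    exact (sq_eq_sq₀ (norm_nonneg _) (norm_nonneg _)).1 h2
  let W : Submodule ℂ H :=
    { carrier := {x | Tendsto (fun n : ℕ => inner ℂ (T^[n] g) x) atTop (nhds 0)}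
      add_mem' := by
        intro a b ha hb
        simp only [mem_ofPred_eq, inner_add_right] at *
        simpa using ha.add hb
      zero_mem' := by simp
      smul_mem' := by
        intro c x hx
        simp only [mem_ofPred_eq, inner_smul_right] at *
        simpa using hx.const_mul c }
  have hW : IsClosed (W : Set H) := by
    refine raj_closed (fun n x => inner ℂ (T^[n] g) x) ‖g‖ ?_
    intro n x y
    rw [← inner_sub_right, ← hno n]
    exact norm_inner_le_norm _ _
  have hmem : ∀ k : ℕ, T^[k] g ∈ W := by
    intro k
    change Tendsto (fun n : ℕ => inner ℂ (T^[n] g) (T^[k] g)) atTop (nhds 0)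
    rw [← tendsto_add_atTop_iff_nat k]
    have : ∀ n : ℕ, inner ℂ (T^[n + k] g) (T^[k] g) = (starRingEnd ℂ) (inner ℂ g (T^[n] g)) := by
      intro n
      rw [add_comm, Function.iterate_add_apply, hin, inner_conj_symm]
    simp_rw [this]
    have h := (Complex.continuous_conj.tendsto 0).comp hg
    rw [map_zero] at h
    exact h
  have : CompleteSpace W := hW.completeSpace_coe
  have hu : u ∈ W := by
    rw [← Submodule.starProjection_add_starProjection_orthogonal (K := W) u]
    refine W.add_mem (by simp) ?_
    change Tendsto _ _ _
    have hz : ∀ n : ℕ, inner ℂ (T^[n] g) (Wᗮ.starProjection u) = 0 := by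
      intro n
      exact (Submodule.mem_orthogonal W _).1 (by simp) _ (hmem n)
    simp only [hz]
    exact tendsto_const_nhds
  exact hu

theorem raj_semi {V : Type*} [SeminormedAddCommGroup V] [InnerProductSpace ℂ V]
    (S T : V →ₗᵢ[ℂ] V) (hTS : ∀ v, T (S v) = v) (L : V →L[ℂ] ℂ)
    (hdec : ∀ v, Tendsto (fun n : ℕ => L (T^[n] v)) atTop (nhds 0)) (v : V) :
    Tendsto (fun n : ℕ => L (S^[n] v)) atTop (nhds 0) := by
  let H := UniformSpace.Completion V
  let ι : V →ₗᵢ[ℂ] H := UniformSpace.Completion.toComplₗᵢ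
  have hd : DenseRange ι := UniformSpace.Completion.denseRange_coe
  let T0 : H →L[ℂ] H := (ι.comp T).toContinuousLinearMap.extend ι.toContinuousLinearMap
  have hT0 : ∀ v, T0 (ι v) = ι (T v) := fun v =>
    ContinuousLinearMap.extend_eq _ hd ι.isometry.isUniformInducing v
  let Th : H →ₗᵢ[ℂ] H :=
    { toLinearMap := T0.toLinearMap
      norm_map' := by
        intro x
        change ‖T0 x‖ = ‖x‖
        refine hd.induction_on (p := fun x => ‖T0 x‖ = ‖x‖) x
          (isClosed_eq (by fun_prop) (by fun_prop)) ?_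
        intro v
        rw [hT0, ι.norm_map, ι.norm_map, T.norm_map] }
  have hTh : ∀ (n : ℕ) v, Th^[n] (ι v) = ι (T^[n] v) := by
    intro n
    induction n with
    | zero => intro v; rfl
    | succ n ih =>
      intro v
      rw [Function.iterate_succ_apply, Function.iterate_succ_apply, ← ih]
      exact congrArg _ (hT0 v)
  let L0 : H →L[ℂ] ℂ := L.extend ι.toContinuousLinearMap
  have hL0 : ∀ v, L0 (ι v) = L v := fun v =>
    ContinuousLinearMap.extend_eq _ hd ι.isometry.isUniformInducing v
  let g : H := (InnerProductSpace.toDual ℂ H).symm L0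
  have hg : ∀ x, inner ℂ g x = L0 x := fun x => InnerProductSpace.toDual_symm_apply
  have hThn : ∀ (n : ℕ) x y, ‖Th^[n] x - Th^[n] y‖ = ‖x - y‖ := by
    intro n
    induction n with
    | zero => intro x y; rfl
    | succ n ih =>
      intro x y
      rw [Function.iterate_succ_apply, Function.iterate_succ_apply, ih, ← map_sub, Th.norm_map]
  have hin : ∀ (n : ℕ) x y, inner ℂ (Th^[n] x) (Th^[n] y) = inner ℂ x y := by
    intro n
    induction n with
    | zero => intro x y; rfl
    | succ n ih => intro x y; rw [Function.iterate_succ_apply, Function.iterate_succ_apply, ih]; simp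
  have h1 : ∀ x, Tendsto (fun n : ℕ => inner ℂ g (Th^[n] x)) atTop (nhds 0) := by
    intro x
    refine hd.induction_on
      (p := fun x => Tendsto (fun n : ℕ => inner ℂ g (Th^[n] x)) atTop (nhds 0)) x ?_ ?_
    · refine raj_closed (fun n x => inner ℂ g (Th^[n] x)) ‖g‖ ?_
      intro n x y
      rw [← inner_sub_right, ← hThn n]
      exact norm_inner_le_norm _ _
    · intro v
      simp_rw [hTh, hg, hL0]
      exact hdec v
  have h2 := raj_hilbert Th g (h1 g) (ι v)
  refine h2.congr ?_
  intro n
  have hTSn : ∀ n : ℕ, T^[n] (S^[n] v) = v := by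
    intro n
    exact (Function.LeftInverse.iterate (f := S) (g := T) hTS n) v
  rw [← hL0, ← hg]
  rw [← hin n g, hTh, hTSn]

theorem raj_core {V : Type*} [AddCommGroup V] [Module ℂ V] (c : PreInnerProductSpace.Core ℂ V)
    (S T : V →ₗ[ℂ] V) (hTS : ∀ v, T (S v) = v)
    (hT : ∀ v, c.inner (T v) (T v) = c.inner v v)
    (hS : ∀ v, c.inner (S v) (S v) = c.inner v v)
    (L : V →ₗ[ℂ] ℂ) (K : ℝ) (hL : ∀ v, ‖L v‖ ≤ K * √ (c.inner v v).re)
    (hdec : ∀ v, Tendsto (fun n : ℕ => L (T^[n] v)) atTop (nhds 0)) (v : V) :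
    Tendsto (fun n : ℕ => L (S^[n] v)) atTop (nhds 0) := by
  let i1 : SeminormedAddCommGroup V := @InnerProductSpace.Core.toSeminormedAddCommGroup ℂ V _ _ _ c
  let i2 : InnerProductSpace ℂ V := InnerProductSpace.ofCore c
  have hn : ∀ v : V, ‖v‖ = √ (c.inner v v).re := fun v => rfl
  exact raj_semi (⟨S, fun v => by rw [hn, hn, hS]⟩) ⟨T, fun v => by rw [hn, hn, hT]⟩ hTS
    (L.mkContinuous K (fun v => by rw [hn]; exact hL v)) hdec v

/-- Evaluation of a Laurent polynomial at `exp (iθ)`. -/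
noncomputable def evL (θ : ℝ) : LaurentPolynomial ℂ →+* ℂ :=
  LaurentPolynomial.eval₂ (RingHom.id ℂ)
    (Units.mk0 (Complex.exp (θ * Complex.I)) (Complex.exp_ne_zero _))

theorem evL_T (θ : ℝ) (k : ℤ) :
    evL θ (LaurentPolynomial.T k) = Complex.exp (k * θ * Complex.I) := by
  unfold evL
  rw [LaurentPolynomial.eval₂_T, Units.val_zpow_eq_zpow_val, Units.val_mk0, ← Complex.exp_int_mul]
  congr 1; ring

theorem evL_C (θ : ℝ) (c : ℂ) : evL θ (LaurentPolynomial.C c) = c := by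
  unfold evL
  rw [LaurentPolynomial.eval₂_C]; rfl

theorem evL_smul (θ : ℝ) (c : ℂ) (p : LaurentPolynomial ℂ) : evL θ (c • p) = c * evL θ p := by
  rw [LaurentPolynomial.smul_eq_C_mul, map_mul, evL_C]

theorem evL_continuous (p : LaurentPolynomial ℂ) : Continuous (fun θ => evL θ p) := by
  induction p using LaurentPolynomial.induction_on' with
  | add p q hp hq => simp only [map_add]; exact hp.add hq
  | C_mul_T n a => simp only [map_mul, evL_T, evL_C]; fun_prop

theorem exp_int_norm (k : ℤ) (θ : ℝ) : ‖Complex.exp (k * θ * Complex.I)‖ = 1 := by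
  have := Complex.norm_exp_ofReal_mul_I (k * θ)
  push_cast at this
  exact this

theorem raj_trig (x y : ℝ) (hxy : x ≤ y) (F : ℝ → ℝ → ℂ) (K : ℝ)
    (hFc : ∀ r, 0 < r → r < 1 → Continuous (F r))
    (hFK : ∀ r, 0 < r → r < 1 → ∫ θ in x..y, ‖F r θ‖ ≤ K)
    (φ : ℝ → ℂ) (hφ : Continuous φ) (hφ1 : ∀ θ, ‖φ θ‖ ≤ 1) (lam : ℤ → ℂ)
    (hlam : ∀ k : ℤ, Tendsto (fun r => ∫ θ in x..y, F r θ * φ θ * Complex.exp (k * θ * Complex.I))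
      (nhdsWithin 1 (Iio 1)) (nhds (lam k)))
    (hdec : Tendsto (fun n : ℕ => lam n) atTop (nhds 0)) :
    Tendsto (fun n : ℕ => lam (-n)) atTop (nhds 0) := by
  have hK0 : 0 ≤ K := le_trans
    (intervalIntegral.integral_nonneg hxy (fun _ _ => norm_nonneg _)) (hFK (1/2) (by norm_num) (by norm_num))
  have hne : (nhdsWithin (1:ℝ) (Iio 1)).NeBot := inferInstance
  let U : Ultrafilter ℝ := Ultrafilter.of (nhdsWithin (1:ℝ) (Iio 1))
  have hU : (U : Filter ℝ) ≤ nhdsWithin (1:ℝ) (Iio 1) := Ultrafilter.of_le _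
  have hUr : ∀ᶠ r in (U : Filter ℝ), 0 < r ∧ r < 1 := by
    refine hU ?_
    exact Ioo_mem_nhdsLT (by norm_num : (0:ℝ) < 1)
  let lm : (ℝ → ℂ) → ℂ := fun f => limUnder (U : Filter ℝ) f
  -- bounded functions converge along `U`
  have hlm : ∀ (f : ℝ → ℂ) (B : ℝ), (∀ r, 0 < r → r < 1 → ‖f r‖ ≤ B) →
      Tendsto f U (nhds (lm f)) := by
    intro f B hB
    refine tendsto_nhds_limUnder ?_
    have h1 : (U.map f : Filter ℂ) ≤ 𝓟 (closedBall (0:ℂ) B) := by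
      rw [le_principal_iff]
      change ∀ᶠ r in (U : Filter ℝ), f r ∈ closedBall (0:ℂ) B
      filter_upwards [hUr] with r hr
      simpa using hB r hr.1 hr.2
    obtain ⟨z, -, hz⟩ := (isCompact_closedBall (0:ℂ) B).ultrafilter_le_nhds (U.map f) h1
    exact ⟨z, hz⟩
  have hlmeq : ∀ (f : ℝ → ℂ) (z : ℂ), Tendsto f U (nhds z) → lm f = z :=
    fun f z h => h.limUnder_eq
  have hbd : ∀ g : ℝ → ℂ, Continuous g → ∃ B, 0 ≤ B ∧ ∀ θ ∈ Icc x y, ‖g θ‖ ≤ B := by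
    intro g hg
    obtain ⟨B, hB⟩ := isCompact_Icc.exists_bound_of_continuousOn (s := Icc x y) hg.continuousOn
    exact ⟨|B|, abs_nonneg _, fun θ hθ => (hB θ hθ).trans (le_abs_self _)⟩
  have hIntG : ∀ (G : ℝ → ℝ → ℂ) (g : ℝ → ℂ), Continuous g →
      (∀ r, 0 < r → r < 1 → Continuous (G r)) →
      (∀ r, 0 < r → r < 1 → ∀ θ, ‖G r θ‖ ≤ ‖F r θ‖) →
      ∃ B, ∀ r, 0 < r → r < 1 → ‖∫ θ in x..y, G r θ * g θ‖ ≤ B := by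
    intro G g hg hGc hG
    obtain ⟨B, hB0, hB⟩ := hbd g hg
    refine ⟨K * B, fun r h0 h1 => ?_⟩
    calc ‖∫ θ in x..y, G r θ * g θ‖ ≤ ∫ θ in x..y, ‖F r θ‖ * B := by
          refine intervalIntegral.norm_integral_le_of_norm_le hxy ?_ ?_
          · refine Eventually.of_forall fun θ hθ => ?_
            rw [norm_mul]
            exact mul_le_mul (hG r h0 h1 θ) (hB θ (Ioc_subset_Icc_self hθ)) (norm_nonneg _) (norm_nonneg _)
          · exact (((hFc r h0 h1).norm).mul continuous_const).intervalIntegrable _ _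
      _ = (∫ θ in x..y, ‖F r θ‖) * B := intervalIntegral.integral_mul_const _ _
      _ ≤ K * B := mul_le_mul_of_nonneg_right (hFK r h0 h1) hB0
  -- the form
  let NF : LaurentPolynomial ℂ → LaurentPolynomial ℂ → ℝ → ℂ := fun p q r =>
    ∫ θ in x..y, (‖F r θ‖ : ℂ) * ((starRingEnd ℂ) (evL θ p) * evL θ q)
  let LF : LaurentPolynomial ℂ → ℝ → ℂ := fun p r => ∫ θ in x..y, (F r θ * φ θ) * evL θ p
  have hcont : ∀ p q, Continuous (fun θ => (starRingEnd ℂ) (evL θ p) * evL θ q) := fun p q =>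
    (Complex.continuous_conj.comp (evL_continuous p)).mul (evL_continuous q)
  have hNFint : ∀ p q r, 0 < r → r < 1 → IntervalIntegrable
      (fun θ => (‖F r θ‖ : ℂ) * ((starRingEnd ℂ) (evL θ p) * evL θ q)) volume x y := by
    intro p q r h0 h1
    exact ((Complex.continuous_ofReal.comp (hFc r h0 h1).norm).mul (hcont p q)).intervalIntegrable _ _
  have hLFint : ∀ p r, 0 < r → r < 1 → IntervalIntegrable
      (fun θ => (F r θ * φ θ) * evL θ p) volume x y := by
    intro p r h0 h1
    exact (((hFc r h0 h1).mul hφ).mul (evL_continuous p)).intervalIntegrable _ _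
  have hN : ∀ p q, Tendsto (NF p q) U (nhds (lm (NF p q))) := by
    intro p q
    obtain ⟨B, hB⟩ := hIntG (fun r θ => (‖F r θ‖ : ℂ)) _ (hcont p q)
      (fun r h0 h1 => Complex.continuous_ofReal.comp (hFc r h0 h1).norm) (fun r _ _ θ => by simp)
    exact hlm _ B hB
  have hLt : ∀ p, Tendsto (LF p) U (nhds (lm (LF p))) := by
    intro p
    obtain ⟨B, hB⟩ := hIntG (fun r θ => F r θ * φ θ) _ (evL_continuous p)
      (fun r h0 h1 => (hFc r h0 h1).mul hφ) (fun r _ _ θ => by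
        rw [norm_mul]; exact mul_le_of_le_one_right (norm_nonneg _) (hφ1 θ))
    exact hlm _ B hB
  have hNFre : ∀ p r, (NF p p r).re = ∫ θ in x..y, ‖F r θ‖ * ‖evL θ p‖ ^ 2 := by
    intro p r
    have : NF p p r = ((∫ θ in x..y, ‖F r θ‖ * ‖evL θ p‖ ^ 2 : ℝ) : ℂ) := by
      rw [← intervalIntegral.integral_ofReal]
      refine intervalIntegral.integral_congr fun θ _ => ?_
      simp only [Complex.conj_mul']
      push_cast; rfl
    rw [this, Complex.ofReal_re]
  let c : PreInnerProductSpace.Core ℂ (LaurentPolynomial ℂ) :=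
    { inner := fun p q => lm (NF p q)
      conj_inner_symm := by
        intro p q
        symm
        refine hlmeq _ _ ?_
        refine ((Complex.continuous_conj.tendsto _).comp (hN q p)).congr ?_
        intro r
        simp only [NF, Function.comp]
        rw [intervalIntegral.intervalIntegral_eq_integral_uIoc,
          intervalIntegral.intervalIntegral_eq_integral_uIoc, Complex.real_smul, Complex.real_smul,
          map_mul, Complex.conj_ofReal, ← integral_conj]
        congr 2
        ext θ
        simp [mul_comm]
      re_inner_nonneg := by
        intro p
        have h := (Complex.continuous_re.tendsto _).comp (hN p p)
        refine ge_of_tendsto h (Eventually.of_forall fun r => ?_)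
        simp only [Function.comp, hNFre]
        exact intervalIntegral.integral_nonneg hxy (fun θ _ => by positivity)
      add_left := by
        intro p q s
        refine hlmeq _ _ (((hN p s).add (hN q s)).congr' ?_)
        filter_upwards [hUr] with r hr
        simp only [NF]
        rw [← intervalIntegral.integral_add (hNFint _ _ r hr.1 hr.2) (hNFint _ _ r hr.1 hr.2)]
        refine intervalIntegral.integral_congr fun θ _ => ?_
        simp only [map_add]; ring
      smul_left := by
        intro p q a
        refine hlmeq _ _ (((hN p q).const_mul _).congr ?_)
        intro r
        simp only [NF]
        rw [← intervalIntegral.integral_const_mul]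
        refine intervalIntegral.integral_congr fun θ _ => ?_
        simp only [evL_smul, map_mul]; ring }
  let L : LaurentPolynomial ℂ →ₗ[ℂ] ℂ :=
    { toFun := fun p => lm (LF p)
      map_add' := by
        intro p q
        refine hlmeq _ _ (((hLt p).add (hLt q)).congr' ?_)
        filter_upwards [hUr] with r hr
        simp only [LF]
        rw [← intervalIntegral.integral_add (hLFint _ r hr.1 hr.2) (hLFint _ r hr.1 hr.2)]
        refine intervalIntegral.integral_congr fun θ _ => ?_
        simp only [map_add]; ring
      map_smul' := by
        intro a p
        refine hlmeq _ _ (((hLt p).const_mul _).congr ?_)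
        intro r
        simp only [LF, RingHom.id_apply]
        rw [← intervalIntegral.integral_const_mul]
        refine intervalIntegral.integral_congr fun θ _ => ?_
        simp only [evL_smul]; ring }
  have hLT : ∀ k : ℤ, L (LaurentPolynomial.T k) = lam k := by
    intro k
    refine hlmeq _ _ (((hlam k).mono_left hU).congr ?_)
    intro r
    simp only [LF, evL_T]
  have hshift : ∀ (k : ℤ) p, c.inner (LaurentPolynomial.T k * p) (LaurentPolynomial.T k * p)
      = c.inner p p := by
    intro k p
    change lm (NF _ _) = lm (NF _ _)
    congr 1
    ext r
    simp only [NF]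
    refine intervalIntegral.integral_congr fun θ _ => ?_
    simp only [Complex.conj_mul']
    simp only [map_mul, norm_mul, evL_T, exp_int_norm, one_mul]
  have hLb : ∀ p, ‖L p‖ ≤ √K * √ (c.inner p p).re := by
    intro p
    have key : ∀ t : ℝ, 0 ≤ K * (t * t) + (-2 * ‖L p‖) * t + (c.inner p p).re := by
      intro t
      have hNp : 0 ≤ (c.inner p p).re := c.re_inner_nonneg p
      rcases le_or_gt t 0 with ht | ht
      · have : 0 ≤ K * (t * t) := mul_nonneg hK0 (mul_self_nonneg t)
        have : 0 ≤ ‖L p‖ * (-t) := mul_nonneg (norm_nonneg _) (by linarith)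
        linarith
      · have h1 : Tendsto (fun r => 2 * t * ‖LF p r‖) U (nhds (2 * t * ‖L p‖)) :=
          (hLt p).norm.const_mul _
        have h2 : Tendsto (fun r => K * (t * t) + (NF p p r).re) U
            (nhds (K * (t * t) + (c.inner p p).re)) :=
          ((Complex.continuous_re.tendsto _).comp (hN p p)).const_add _
        have h3 : 2 * t * ‖L p‖ ≤ K * (t * t) + (c.inner p p).re := by
          refine le_of_tendsto_of_tendsto h1 h2 ?_
          filter_upwards [hUr] with r hr
          rw [hNFre]
          have e1 : IntervalIntegrable (fun θ => ‖F r θ‖ * (t * t)) volume x y :=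
            ((hFc r hr.1 hr.2).norm.mul continuous_const).intervalIntegrable _ _
          have e2 : IntervalIntegrable (fun θ => ‖F r θ‖ * ‖evL θ p‖ ^ 2) volume x y :=
            ((hFc r hr.1 hr.2).norm.mul ((evL_continuous p).norm.pow 2)).intervalIntegrable _ _
          calc 2 * t * ‖LF p r‖ = ‖∫ θ in x..y, (2 * t : ℂ) * ((F r θ * φ θ) * evL θ p)‖ := by
                rw [intervalIntegral.integral_const_mul, norm_mul]
                congr 1
                simp [abs_of_pos ht]
            _ ≤ ∫ θ in x..y, (‖F r θ‖ * (t * t) + ‖F r θ‖ * ‖evL θ p‖ ^ 2) := by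
                refine intervalIntegral.norm_integral_le_of_norm_le hxy ?_ (e1.add e2)
                refine Eventually.of_forall fun θ _ => ?_
                simp only [norm_mul, Complex.norm_real, Complex.norm_ofNat, Real.norm_eq_abs, abs_of_pos ht]
                have a1 : ‖F r θ‖ * ‖φ θ‖ ≤ ‖F r θ‖ :=
                  mul_le_of_le_one_right (norm_nonneg _) (hφ1 θ)
                have a2 : 0 ≤ 2 * t * ‖evL θ p‖ := by positivity
                have a3 := mul_le_mul_of_nonneg_right a1 a2
                have a4 := mul_nonneg (norm_nonneg (F r θ)) (sq_nonneg (t - ‖evL θ p‖))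
                nlinarith
            _ = (∫ θ in x..y, ‖F r θ‖) * (t * t) + ∫ θ in x..y, ‖F r θ‖ * ‖evL θ p‖ ^ 2 := by
                rw [intervalIntegral.integral_add e1 e2, intervalIntegral.integral_mul_const]
            _ ≤ _ := by
                have := mul_le_mul_of_nonneg_right (hFK r hr.1 hr.2) (mul_self_nonneg t)
                linarith
        linarith
    have hd := discrim_le_zero key
    unfold discrim at hd
    rw [← Real.sqrt_mul hK0]
    refine Real.le_sqrt_of_sq_le ?_
    nlinarith
  have hiter : ∀ (k : ℤ) (n : ℕ) p, (LinearMap.mulLeft ℂ (LaurentPolynomial.T k : LaurentPolynomial ℂ))^[n] p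
      = LaurentPolynomial.T (n * k) * p := by
    intro k n
    induction n with
    | zero => intro p; simp
    | succ n ih =>
      intro p
      rw [Function.iterate_succ_apply, ih, LinearMap.mulLeft_apply, ← mul_assoc, ← LaurentPolynomial.T_add]
      congr 2
      push_cast; ring
  have hfin := raj_core c (LinearMap.mulLeft ℂ (LaurentPolynomial.T (-1)))
    (LinearMap.mulLeft ℂ (LaurentPolynomial.T 1))
    (fun v => by
      rw [LinearMap.mulLeft_apply, LinearMap.mulLeft_apply, ← mul_assoc, ← LaurentPolynomial.T_add]
      simp) (hshift 1) (hshift (-1)) L (√K) hLb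
    (by
      intro v
      simp only [hiter]
      induction v using LaurentPolynomial.induction_on' with
      | add p q hp hq =>
        simp only [mul_add, map_add]
        simpa using hp.add hq
      | C_mul_T m a =>
        have : ∀ n : ℕ, L (LaurentPolynomial.T (n * 1) * (LaurentPolynomial.C a * LaurentPolynomial.T m))
            = a * lam (n + m) := by
          intro n
          rw [← mul_assoc, mul_comm (LaurentPolynomial.T _), mul_assoc, ← LaurentPolynomial.T_add,
            ← LaurentPolynomial.smul_eq_C_mul, map_smul, hLT, mul_one, smul_eq_mul]
        simp only [this]
        have h4 : Tendsto (fun n : ℕ => lam (n + m)) atTop (nhds 0) := by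
          have h5 : Tendsto (fun n : ℕ => ((n : ℤ) + m).toNat) atTop atTop := by
            refine tendsto_atTop.2 fun b => ?_
            filter_upwards [eventually_ge_atTop (b + m.natAbs)] with n hn
            omega
          refine (hdec.comp h5).congr' ?_
          filter_upwards [eventually_ge_atTop m.natAbs] with n hn
          simp only [Function.comp]
          congr 1
          omega
        simpa using h4.const_mul a) 1
  refine hfin.congr fun n => ?_
  rw [hiter, mul_one, hLT]
  congr 1
  ring

theorem ibp_exp (p p1 : ℝ → ℂ) (x y : ℝ) (h1 : ∀ θ, HasDerivAt p (p1 θ) θ)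
    (hc : Continuous p1) (hy : y = x + 2 * Real.pi) (hper : p y = p x) (m : ℤ) :
    ∫ θ in x..y, p1 θ * Complex.exp (m * θ * Complex.I)
      = -(m * Complex.I) * ∫ θ in x..y, p θ * Complex.exp (m * θ * Complex.I) := by
  have he : ∀ θ : ℝ, HasDerivAt (fun θ : ℝ => Complex.exp (m * θ * Complex.I))
      (Complex.exp (m * θ * Complex.I) * (m * Complex.I)) θ := by
    intro θ
    have h : HasDerivAt (fun θ : ℝ => (m * θ * Complex.I : ℂ)) (m * Complex.I) θ := by
      have := ((Complex.ofRealCLM.hasDerivAt (x := θ)).const_mul (m : ℂ)).mul_const Complex.I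
      simpa using this
    exact h.cexp
  have hpc : Continuous p := continuous_iff_continuousAt.2 fun θ => (h1 θ).continuousAt
  have hib := intervalIntegral.integral_mul_deriv_eq_deriv_mul (a := x) (b := y)
    (u := p) (u' := p1) (v := fun θ : ℝ => Complex.exp (m * θ * Complex.I))
    (v' := fun θ : ℝ => Complex.exp (m * θ * Complex.I) * (m * Complex.I))
    (fun θ _ => h1 θ) (fun θ _ => he θ) (hc.intervalIntegrable _ _)
    (Continuous.intervalIntegrable (by fun_prop) _ _)
  have hexp : Complex.exp (m * (y : ℝ) * Complex.I) = Complex.exp (m * (x : ℝ) * Complex.I) := by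
    rw [Complex.exp_eq_exp_iff_exists_int]
    refine ⟨m, ?_⟩
    rw [hy]; push_cast; ring
  rw [hper, hexp, sub_self, zero_sub] at hib
  have h3 : ∫ θ in x..y, p θ * (Complex.exp (m * θ * Complex.I) * (m * Complex.I))
      = (m * Complex.I) * ∫ θ in x..y, p θ * Complex.exp (m * θ * Complex.I) := by
    rw [← intervalIntegral.integral_const_mul]
    refine intervalIntegral.integral_congr fun θ _ => ?_
    ring
  rw [h3] at hib
  rw [neg_mul, hib, neg_neg]

theorem fourier_bound (p p1 p2 : ℝ → ℂ) (x y : ℝ) (h1 : ∀ θ, HasDerivAt p (p1 θ) θ)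
    (h2 : ∀ θ, HasDerivAt p1 (p2 θ) θ) (hc : Continuous p2)
    (hy : y = x + 2 * Real.pi) (hper : p y = p x) (hper1 : p1 y = p1 x)
    (K : ℝ) (hK : ∀ θ ∈ Icc x y, ‖p θ‖ ≤ K) (hK2 : ∀ θ ∈ Icc x y, ‖p2 θ‖ ≤ K) (m : ℤ) :
    ‖∫ θ in x..y, p θ * Complex.exp (m * θ * Complex.I)‖ ≤ 4 * Real.pi * K * (1 + (m:ℝ)^2)⁻¹ := by
  have hpc : Continuous p := continuous_iff_continuousAt.2 fun θ => (h1 θ).continuousAt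
  have hpc1 : Continuous p1 := continuous_iff_continuousAt.2 fun θ => (h2 θ).continuousAt
  have hxy : x ≤ y := by rw [hy]; linarith [Real.pi_pos]
  have e1 := ibp_exp p p1 x y h1 hpc1 hy hper m
  have e2 := ibp_exp p1 p2 x y h2 hc hy hper1 m
  set J := ∫ θ in x..y, p θ * Complex.exp (m * θ * Complex.I) with hJ
  have e3 : ((1 + (m:ℝ)^2 : ℝ) : ℂ) * J = ∫ θ in x..y, (p θ - p2 θ) * Complex.exp (m * θ * Complex.I) := by
    simp_rw [sub_mul]
    rw [intervalIntegral.integral_sub (Continuous.intervalIntegrable (by fun_prop) _ _)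
      (Continuous.intervalIntegrable (by fun_prop) _ _), e2, e1, ← hJ]
    push_cast
    linear_combination ((m:ℂ)^2 * J) * Complex.I_sq
  have e4 : ‖∫ θ in x..y, (p θ - p2 θ) * Complex.exp (m * θ * Complex.I)‖ ≤ (2 * K) * |y - x| := by
    refine intervalIntegral.norm_integral_le_of_norm_le_const fun θ hθ => ?_
    rw [uIoc_of_le hxy] at hθ
    rw [norm_mul, exp_int_norm, mul_one]
    have := norm_sub_le (p θ) (p2 θ)
    linarith [hK θ (Ioc_subset_Icc_self hθ), hK2 θ (Ioc_subset_Icc_self hθ)]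
  rw [← e3, norm_mul, Complex.norm_real, Real.norm_eq_abs, abs_of_pos (by positivity)] at e4
  have e5 : |y - x| = 2 * Real.pi := by rw [hy, add_sub_cancel_left, abs_of_pos Real.two_pi_pos]
  rw [e5] at e4
  rw [← div_eq_mul_inv, le_div_iff₀ (by positivity)]
  linarith

theorem bump_exists (θ₀ η : ℝ) (h0 : 0 < η) (hπ : η < Real.pi) :
    ∃ ψ ψ1 ψ2 : ℝ → ℂ, ∃ ε > (0:ℝ), (∀ θ, HasDerivAt ψ (ψ1 θ) θ) ∧
      (∀ θ, HasDerivAt ψ1 (ψ2 θ) θ) ∧ Continuous ψ2 ∧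
      (∀ θ, ψ (θ + 2 * Real.pi) = ψ θ) ∧ (∀ θ, ψ1 (θ + 2 * Real.pi) = ψ1 θ) ∧
      (∀ θ : ℝ, ‖Complex.exp (θ * Complex.I) - Complex.exp (θ₀ * Complex.I)‖ < ε →
        ∀ᶠ t in nhds θ, ψ t = 0 ∧ ψ1 t = 0 ∧ ψ2 t = 0) ∧
      (∀ θ ∈ Icc (θ₀ - Real.pi) (θ₀ + Real.pi), η ≤ |θ - θ₀| → ψ θ = 1) ∧
      (∀ θ, ‖1 - ψ θ‖ ≤ 1) := by
  set d := 1 - Real.cos η with hd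
  have hd0 : 0 < d := by
    have : Real.cos η < Real.cos 0 := Real.cos_lt_cos_of_nonneg_of_le_pi le_rfl hπ.le h0
    rw [Real.cos_zero] at this
    linarith
  let P : ℝ → ℝ := fun θ => Real.smoothTransition (2 * (1 - Real.cos (θ - θ₀)) / d - 1)
  have hP : ContDiff ℝ (⊤ : ℕ∞) P := by
    refine Real.smoothTransition.contDiff.comp ?_
    have : ContDiff ℝ (⊤ : ℕ∞) (fun θ => Real.cos (θ - θ₀)) :=
      Real.contDiff_cos.comp (contDiff_id.sub contDiff_const)
    exact ((contDiff_const.mul (contDiff_const.sub this)).div_const _).sub contDiff_const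
  have hP1 : ContDiff ℝ (⊤ : ℕ∞) (deriv P) := (contDiff_infty_iff_deriv.1 hP).2
  have hP2 : ContDiff ℝ (⊤ : ℕ∞) (deriv (deriv P)) := (contDiff_infty_iff_deriv.1 hP1).2
  have hper : ∀ θ, P (θ + 2 * Real.pi) = P θ := by
    intro θ
    simp only [P]
    rw [show θ + 2 * Real.pi - θ₀ = (θ - θ₀) + 2 * Real.pi by ring, Real.cos_add_two_pi]
  have hper1 : ∀ θ, deriv P (θ + 2 * Real.pi) = deriv P θ := by
    intro θ
    rw [← deriv_comp_add_const]
    congr 1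
    ext t; exact hper t
  refine ⟨fun θ => ((P θ : ℝ) : ℂ), fun θ => ((deriv P θ : ℝ) : ℂ),
    fun θ => ((deriv (deriv P) θ : ℝ) : ℂ), √ d, Real.sqrt_pos.2 hd0,
    ?_, ?_, ?_, ?_, ?_, ?_, ?_, ?_⟩
  · intro θ
    exact ((hP.differentiable (by simp)) θ).hasDerivAt.ofReal_comp
  · intro θ
    exact ((hP1.differentiable (by simp)) θ).hasDerivAt.ofReal_comp
  · exact Complex.continuous_ofReal.comp hP2.continuous
  · intro θ; simp only [hper]
  · intro θ; simp only [hper1]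
  · intro θ hθ
    have hcos : 2 * (1 - Real.cos (θ - θ₀)) < d := by
      have hn : ‖Complex.exp (θ * Complex.I) - Complex.exp (θ₀ * Complex.I)‖ ^ 2
          = 2 * (1 - Real.cos (θ - θ₀)) := by
        rw [← Complex.normSq_eq_norm_sq, Complex.normSq_apply]
        simp only [Complex.sub_re, Complex.sub_im, Complex.exp_ofReal_mul_I_re,
          Complex.exp_ofReal_mul_I_im]
        rw [Real.cos_sub]
        nlinarith [Real.sin_sq_add_cos_sq θ, Real.sin_sq_add_cos_sq θ₀]
      rw [← hn]
      exact (Real.lt_sqrt (norm_nonneg _)).1 hθ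
    have hev : P =ᶠ[nhds θ] fun _ => 0 := by
      have hc : Continuous fun t => 2 * (1 - Real.cos (t - θ₀)) := by fun_prop
      filter_upwards [(hc.tendsto θ).eventually (gt_mem_nhds hcos)] with t ht
      refine Real.smoothTransition.zero_of_nonpos ?_
      have : 2 * (1 - Real.cos (t - θ₀)) / d < 1 := (div_lt_one hd0).2 ht
      linarith
    have hev1 : deriv P =ᶠ[nhds θ] fun _ => 0 := by simpa using hev.deriv
    have hev2 : deriv (deriv P) =ᶠ[nhds θ] fun _ => 0 := by simpa using hev1.deriv
    filter_upwards [hev, hev1, hev2] with t h1 h2 h3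
    simp [h1, h2, h3]
  · intro θ hθ hη
    have hcos : Real.cos (θ - θ₀) ≤ Real.cos η := by
      rw [← Real.cos_abs (θ - θ₀)]
      refine Real.cos_le_cos_of_nonneg_of_le_pi h0.le ?_ hη
      rw [abs_le]
      constructor <;> linarith [hθ.1, hθ.2]
    have : P θ = 1 := by
      refine Real.smoothTransition.one_of_one_le ?_
      have : 2 ≤ 2 * (1 - Real.cos (θ - θ₀)) / d := by
        rw [le_div_iff₀ hd0]
        linarith
      linarith
    simp [this]
  · intro θ
    have h1 : P θ ≤ 1 := Real.smoothTransition.le_one _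
    have h2 : 0 ≤ P θ := Real.smoothTransition.nonneg _
    rw [← Complex.ofReal_one, ← Complex.ofReal_sub, Complex.norm_real, Real.norm_eq_abs, abs_le]
    constructor <;> linarith

theorem summable_int_sq : Summable (fun m : ℤ => (1 + (m:ℝ)^2)⁻¹) := by
  have h : Summable (fun m : ℤ => 1 / (m:ℝ)^2) := Real.summable_one_div_int_pow.2 (by norm_num)
  refine Summable.of_norm_bounded_eventually (g := fun m : ℤ => 1 / (m:ℝ)^2) h ?_
  have : ({0} : Set ℤ)ᶜ ∈ (cofinite : Filter ℤ) := (finite_singleton 0).compl_mem_cofinite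
  filter_upwards [this] with m hm
  have hm' : (m:ℝ) ≠ 0 := by exact_mod_cast hm
  rw [Real.norm_eq_abs, abs_of_pos (by positivity), one_div]
  refine inv_anti₀ (by positivity) (by linarith)

theorem right_limit_pair (a : ℕ → ℂ) (C : ℝ) (hC : ∀ n, ‖a n‖ ≤ C) (b : ℤ → ℂ)
    (n : ℕ → ℕ) (hn : StrictMono n)
    (hb : ∀ k : ℤ, Tendsto (fun j => a (k + n j).toNat) atTop (nhds (b k)))
    (Φ : ℤ → ℂ) (hΦ : Summable fun m => ‖Φ m‖)
    (hlam : Tendsto (fun N : ℕ => ∑' i : ℕ, a i * Φ (i + (-N : ℤ))) atTop (nhds 0)) (l : ℤ) :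
    ∑' m : ℤ, b m * Φ (m + l) = 0 := by
  have hnt : Tendsto n atTop atTop := hn.tendsto_atTop
  have hC0 : 0 ≤ C := (norm_nonneg _).trans (hC 0)
  let A : ℕ → ℤ → ℂ := fun j m => if 0 ≤ m + n j then a (m + n j).toNat else 0
  have h1 : Tendsto (fun j => ∑' m : ℤ, A j m * Φ (m + l)) atTop (nhds (∑' m : ℤ, b m * Φ (m + l))) := by
    refine tendsto_tsum_of_dominated_convergence (bound := fun m => C * ‖Φ (m + l)‖) ?_ ?_ ?_
    · exact (((Equiv.addRight l).summable_iff (f := fun m => ‖Φ m‖)).2 hΦ).mul_left C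
    · intro m
      refine Tendsto.mul_const _ ((hb m).congr' ?_)
      filter_upwards [hnt.eventually_ge_atTop m.natAbs] with j hj
      simp only [A]
      rw [if_pos (by omega)]
    · refine Eventually.of_forall fun j m => ?_
      rw [norm_mul]
      refine mul_le_mul_of_nonneg_right ?_ (norm_nonneg _)
      simp only [A]
      split_ifs
      · exact hC _
      · simpa using hC0
  have h2 : ∀ j, (l : ℤ) ≤ n j → ∑' m : ℤ, A j m * Φ (m + l) =
      ∑' i : ℕ, a i * Φ (i + (-((n j - l).toNat : ℕ) : ℤ)) := by
    intro j hj
    have hj' : (((n j - l : ℤ).toNat : ℕ) : ℤ) = n j - l := Int.toNat_of_nonneg (by omega)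
    rw [hj', ← (Equiv.subRight (n j : ℤ)).tsum_eq]
    have hinj : Function.Injective (fun i : ℕ => (i : ℤ)) := Nat.cast_injective
    rw [← hinj.tsum_eq]
    · refine tsum_congr fun i => ?_
      simp only [A, Equiv.subRight_apply, sub_add_cancel]
      rw [if_pos (by omega), Int.toNat_natCast]
      congr 2
      ring
    · intro m hm
      by_contra hcon
      apply hm
      simp only [A, Equiv.subRight_apply, sub_add_cancel]
      rw [if_neg, zero_mul]
      intro h0
      exact hcon ⟨m.toNat, Int.toNat_of_nonneg h0⟩
  have h3 : Tendsto (fun j => (n j - l : ℤ).toNat) atTop atTop := by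
    refine tendsto_atTop.2 fun B => ?_
    filter_upwards [hnt.eventually_ge_atTop (B + l.natAbs)] with j hj
    omega
  refine tendsto_nhds_unique h1 ((hlam.comp h3).congr' ?_)
  filter_upwards [hnt.eventually_ge_atTop l.natAbs] with j hj
  rw [h2 j (by omega)]
  rfl

theorem recur_sum (b : ℤ → ℂ) (C : ℝ) (hb : ∀ m, ‖b m‖ ≤ C) (S : ℤ → ℂ) (D : ℝ)
    (hS : ∀ l, ‖S l‖ ≤ D) (z : ℂ) (hrec : ∀ l, S l = b l + z * S (l + 1)) :
    (‖z‖ < 1 → S 0 = fPlus b z) ∧ (1 < ‖z‖ → S 0 = - fMinus b z) := by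
  constructor
  · intro hz
    have h1 : ∀ N : ℕ, ∑ i ∈ Finset.range N, b i * z ^ i = S 0 - z ^ N * S N := by
      intro N
      induction N with
      | zero => simp
      | succ N ih =>
        rw [Finset.sum_range_succ, ih, hrec N]
        push_cast; ring
    have hs : Summable (fun i : ℕ => b i * z ^ i) := by
      refine Summable.of_norm_bounded (g := fun i => C * ‖z‖ ^ i)
        ((summable_geometric_of_lt_one (norm_nonneg _) hz).mul_left C) fun i => ?_
      rw [norm_mul, norm_pow]
      exact mul_le_mul_of_nonneg_right (hb _) (by positivity)
    have h2 := hs.hasSum.tendsto_sum_nat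
    have h3 : Tendsto (fun N : ℕ => z ^ N * S N) atTop (nhds 0) := by
      have h4 : Tendsto (fun N : ℕ => ‖z‖ ^ N * D) atTop (nhds (0 * D)) :=
        (tendsto_pow_atTop_nhds_zero_of_lt_one (norm_nonneg _) hz).mul_const D
      rw [zero_mul] at h4
      refine squeeze_zero_norm (fun N => ?_) h4
      rw [norm_mul, norm_pow]
      exact mul_le_mul_of_nonneg_left (hS _) (by positivity)
    have h5 := h3.const_sub (S 0)
    rw [sub_zero] at h5
    exact tendsto_nhds_unique h5 (h2.congr h1)
  · intro hz
    have hz0 : z ≠ 0 := by rintro rfl; simp at hz; linarith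
    have hzi : ‖z⁻¹‖ < 1 := by rw [norm_inv]; exact inv_lt_one_of_one_lt₀ hz
    have hpw : ∀ i : ℕ, z ^ (-(i:ℤ) - 1) = z⁻¹ ^ (i + 1) := by
      intro i
      rw [show (-(i:ℤ) - 1) = -((i + 1 : ℕ) : ℤ) by push_cast; ring, zpow_neg, zpow_natCast, inv_pow]
    have h1 : ∀ N : ℕ, ∑ i ∈ Finset.range N, b (-(i:ℤ) - 1) * z ^ (-(i:ℤ) - 1)
        = z⁻¹ ^ N * S (-N) - S 0 := by
      intro N
      induction N with
      | zero => simp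
      | succ N ih =>
        have h := hrec (-(N:ℤ) - 1)
        rw [sub_add_cancel] at h
        rw [Finset.sum_range_succ, ih, hpw,
          show (-((N + 1 : ℕ) : ℤ)) = -(N:ℤ) - 1 by push_cast; ring, h, pow_succ]
        field_simp
        ring
    have hs : Summable (fun i : ℕ => b (-(i:ℤ) - 1) * z ^ (-(i:ℤ) - 1)) := by
      refine Summable.of_norm_bounded (g := fun i => C * ‖z⁻¹‖ ^ (i + 1))
        (((summable_nat_add_iff 1).2
          (summable_geometric_of_lt_one (norm_nonneg _) hzi)).mul_left C) fun i => ?_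
      rw [norm_mul, hpw, norm_pow]
      exact mul_le_mul_of_nonneg_right (hb _) (by positivity)
    have h2 := hs.hasSum.tendsto_sum_nat
    have h3 : Tendsto (fun N : ℕ => z⁻¹ ^ N * S (-N)) atTop (nhds 0) := by
      have h4 : Tendsto (fun N : ℕ => ‖z⁻¹‖ ^ N * D) atTop (nhds (0 * D)) :=
        (tendsto_pow_atTop_nhds_zero_of_lt_one (norm_nonneg _) hzi).mul_const D
      rw [zero_mul] at h4
      refine squeeze_zero_norm (fun N => ?_) h4
      rw [norm_mul, norm_pow]
      exact mul_le_mul_of_nonneg_left (hS _) (by positivity)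
    have h5 := h3.sub_const (S 0)
    rw [zero_sub] at h5
    have h6 := tendsto_nhds_unique h5 (h2.congr h1)
    rw [← neg_eq_iff_eq_neg, h6]; rfl

theorem vanish_pair (a : ℕ → ℂ) (C : ℝ) (hC : ∀ n, ‖a n‖ ≤ C)
    (f : ℂ → ℂ) (hf : ∀ z ∈ Metric.ball (0 : ℂ) 1, f z = ∑' n : ℕ, a n * z ^ n)
    (θ₀ η K : ℝ) (hη : 0 < η) (hηπ : η < Real.pi)
    (hK : ∀ r : ℝ, 0 < r → r < 1 →
      ∫ θ in (θ₀ - η)..(θ₀ + η), ‖f (r * Complex.exp (θ * Complex.I))‖ ≤ K)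
    (φ : ℝ → ℂ) (hφ : Continuous φ) (hφ1 : ∀ θ, ‖φ θ‖ ≤ 1)
    (hφ0 : ∀ θ ∈ Icc (θ₀ - Real.pi) (θ₀ + Real.pi), η ≤ |θ - θ₀| → φ θ = 0)
    (Φ : ℤ → ℂ) (hΦ : ∀ m : ℤ, Φ m = ∫ θ in (θ₀ - Real.pi)..(θ₀ + Real.pi),
      φ θ * Complex.exp (m * θ * Complex.I))
    (B : ℝ) (hB : ∀ m : ℤ, ‖Φ m‖ ≤ B * (1 + (m:ℝ)^2)⁻¹)
    (b : ℤ → ℂ) (hb : IsRightLimit a b) (l : ℤ) :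
    ∑' m : ℤ, b m * Φ (m + l) = 0 := by
  have hB0 : 0 ≤ B := by
    have := (norm_nonneg _).trans (hB 0)
    simpa using this
  have hC0 : 0 ≤ C := (norm_nonneg _).trans (hC 0)
  have hsΦ : Summable fun m => ‖Φ m‖ :=
    Summable.of_nonneg_of_le (fun _ => norm_nonneg _) hB (summable_int_sq.mul_left B)
  have hsΦk : ∀ k : ℤ, Summable fun i : ℕ => C * ‖Φ (i + k)‖ := by
    intro k
    refine Summable.mul_left C ?_
    have hinj : Function.Injective (fun i : ℕ => (i : ℤ) + k) := fun i j h => by simpa using h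
    exact hsΦ.comp_injective hinj
  have hpos : ∀ (r : ℝ) (θ : ℝ), 0 < r → ‖(r * Complex.exp (θ * Complex.I) : ℂ)‖ = r := by
    intro r θ hr
    rw [norm_mul, Complex.norm_exp_ofReal_mul_I, Complex.norm_real, Real.norm_eq_abs, abs_of_pos hr, mul_one]
  let t : ℝ → ℕ → ℝ → ℂ := fun r i θ => a i * (r * Complex.exp (θ * Complex.I)) ^ i
  have htn : ∀ r i θ, 0 < r → ‖t r i θ‖ ≤ C * r ^ i := by
    intro r i θ hr
    simp only [t]
    rw [norm_mul, norm_pow, hpos r θ hr]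
    exact mul_le_mul_of_nonneg_right (hC i) (by positivity)
  have hgs : ∀ r : ℝ, 0 < r → r < 1 → Summable (fun i : ℕ => C * r ^ i) := fun r h0 h1 =>
    (summable_geometric_of_lt_one h0.le h1).mul_left C
  have hft : ∀ r : ℝ, 0 < r → r < 1 → ∀ θ : ℝ, f (r * Complex.exp (θ * Complex.I)) = ∑' i, t r i θ := by
    intro r h0 h1 θ
    exact hf _ (by rw [mem_ball_zero_iff, hpos r θ h0]; exact h1)
  have hFc : ∀ r : ℝ, 0 < r → r < 1 → Continuous fun θ : ℝ => f (r * Complex.exp (θ * Complex.I)) := by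
    intro r h0 h1
    simp_rw [hft r h0 h1]
    exact continuous_tsum (fun i => by simp only [t]; fun_prop) (hgs r h0 h1) (fun i θ => htn r i θ h0)
  have hIntG : ∀ (k : ℤ) (r : ℝ), 0 < r → r < 1 →
      ∫ θ in (θ₀ - η)..(θ₀ + η), f (r * Complex.exp (θ * Complex.I)) * φ θ * Complex.exp (k * θ * Complex.I)
        = ∑' i : ℕ, a i * r ^ i * Φ (i + k) := by
    intro k r h0 h1
    have hFc' := hFc r h0 h1
    set G : ℝ → ℂ := fun θ => f (r * Complex.exp (θ * Complex.I)) * φ θ * Complex.exp (k * θ * Complex.I) with hG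
    have hGc : Continuous G := (hFc'.mul hφ).mul (by fun_prop)
    have z1 : ∫ θ in (θ₀ - Real.pi)..(θ₀ - η), G θ = 0 := by
      refine intervalIntegral.integral_zero_ae (Eventually.of_forall fun θ hθ => ?_)
      rw [uIoc_of_le (by linarith)] at hθ
      simp only [hG]
      rw [hφ0 θ ⟨hθ.1.le, by linarith [hθ.2]⟩ (by rw [abs_of_nonpos] <;> linarith [hθ.2])]
      ring
    have z2 : ∫ θ in (θ₀ + η)..(θ₀ + Real.pi), G θ = 0 := by
      refine intervalIntegral.integral_zero_ae (Eventually.of_forall fun θ hθ => ?_)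
      rw [uIoc_of_le (by linarith)] at hθ
      simp only [hG]
      rw [hφ0 θ ⟨by linarith [hθ.1], hθ.2⟩ (by rw [abs_of_nonneg] <;> linarith [hθ.1])]
      ring
    have z3 : ∫ θ in (θ₀ - η)..(θ₀ + η), G θ = ∫ θ in (θ₀ - Real.pi)..(θ₀ + Real.pi), G θ := by
      have w1 := intervalIntegral.integral_add_adjacent_intervals
        (hGc.intervalIntegrable (μ := volume) (θ₀ - Real.pi) (θ₀ - η))
        (hGc.intervalIntegrable (θ₀ - η) (θ₀ + Real.pi))
      have w2 := intervalIntegral.integral_add_adjacent_intervals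
        (hGc.intervalIntegrable (μ := volume) (θ₀ - η) (θ₀ + η))
        (hGc.intervalIntegrable (θ₀ + η) (θ₀ + Real.pi))
      rw [← w1, ← w2, z1, z2]
      ring
    rw [z3]
    have hs := intervalIntegral.hasSum_integral_of_dominated_convergence (μ := volume)
      (a := θ₀ - Real.pi) (b := θ₀ + Real.pi) (f := G)
      (F := fun i θ => t r i θ * φ θ * Complex.exp (k * θ * Complex.I))
      (bound := fun i _ => C * r ^ i)
      (fun i => Continuous.aestronglyMeasurable (by simp only [t]; fun_prop))
      (fun i => Eventually.of_forall fun θ _ => by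
        rw [norm_mul, exp_int_norm, mul_one, norm_mul]
        exact (mul_le_of_le_one_right (norm_nonneg _) (hφ1 θ)).trans (htn r i θ h0))
      (Eventually.of_forall fun θ _ => hgs r h0 h1)
      (intervalIntegrable_const)
      (Eventually.of_forall fun θ _ => by
        simp only [hG]
        rw [hft r h0 h1]
        have : Summable (fun i => t r i θ) :=
          Summable.of_norm_bounded (hgs r h0 h1) (fun i => htn r i θ h0)
        exact (this.hasSum.mul_right _).mul_right _)
    rw [← hs.tsum_eq]
    refine tsum_congr fun i => ?_
    rw [hΦ, ← intervalIntegral.integral_const_mul]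
    refine intervalIntegral.integral_congr fun θ _ => ?_
    simp only [t]
    rw [mul_pow, ← Complex.exp_nat_mul]
    have : Complex.exp (((i + k : ℤ) : ℂ) * θ * Complex.I)
        = Complex.exp (i * (θ * Complex.I)) * Complex.exp (k * θ * Complex.I) := by
      rw [← Complex.exp_add]; congr 1; push_cast; ring
    rw [this]; ring
  obtain ⟨n, hn, hnb⟩ := hb
  refine right_limit_pair a C hC b n hn hnb Φ hsΦ ?_ l
  refine raj_trig (θ₀ - η) (θ₀ + η) (by linarith) (fun r θ => f (r * Complex.exp (θ * Complex.I))) K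
    hFc hK φ hφ hφ1 (fun k => ∑' i : ℕ, a i * Φ (i + k)) ?_ ?_
  · intro k
    have hev : ∀ᶠ r in nhdsWithin (1:ℝ) (Iio 1), 0 < r ∧ r < 1 :=
      Ioo_mem_nhdsLT (by norm_num : (0:ℝ) < 1)
    have h1 : Tendsto (fun r : ℝ => ∑' i : ℕ, a i * (r:ℂ) ^ i * Φ (i + k)) (nhdsWithin (1:ℝ) (Iio 1))
        (nhds (∑' i : ℕ, a i * Φ (i + k))) := by
      refine tendsto_tsum_of_dominated_convergence (hsΦk k) ?_ ?_
      · intro i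
        have hc : Continuous fun r : ℝ => a i * (r:ℂ) ^ i * Φ (i + k) := by fun_prop
        have := (hc.tendsto 1).mono_left (nhdsWithin_le_nhds (s := Iio 1))
        simpa using this
      · filter_upwards [hev] with r hr i
        rw [norm_mul, norm_mul, norm_pow, Complex.norm_real, Real.norm_eq_abs, abs_of_pos hr.1]
        refine mul_le_mul_of_nonneg_right ?_ (norm_nonneg _)
        calc ‖a i‖ * r ^ i ≤ C * 1 :=
              mul_le_mul (hC i) (pow_le_one₀ hr.1.le hr.2.le) (pow_nonneg hr.1.le _) hC0
          _ = C := mul_one C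
    refine h1.congr' ?_
    filter_upwards [hev] with r hr
    exact (hIntG k r hr.1 hr.2).symm
  · have hz : Tendsto (fun N : ℕ => ∑' i : ℕ, a i * Φ (i + N)) atTop (nhds (∑' i : ℕ, (0:ℂ))) := by
      refine tendsto_tsum_of_dominated_convergence
        (bound := fun i : ℕ => C * (B * (1 + ((i : ℤ) : ℝ)^2)⁻¹)) ?_ ?_ ?_
      · have hinj : Function.Injective (fun i : ℕ => (i : ℤ)) := Nat.cast_injective
        exact ((summable_int_sq.comp_injective hinj).mul_left B).mul_left C
      · intro i
        have h1 : Tendsto Φ cofinite (nhds 0) := (tendsto_zero_iff_norm_tendsto_zero.2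
          hsΦ.tendsto_cofinite_zero)
        have hinj : Function.Injective (fun N : ℕ => (i : ℤ) + N) := fun i j h => by simpa using h
        have h2 := (h1.comp hinj.tendsto_cofinite)
        rw [Nat.cofinite_eq_atTop] at h2
        simpa using h2.const_mul (a i)
      · refine Eventually.of_forall fun N i => ?_
        rw [norm_mul]
        refine mul_le_mul (hC i) ((hB _).trans ?_) (norm_nonneg _) hC0
        refine mul_le_mul_of_nonneg_left ?_ hB0
        refine inv_anti₀ (by positivity) ?_
        push_cast
        have : (0:ℝ) ≤ i := by positivity
        have : (0:ℝ) ≤ N := by positivity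
        nlinarith
    rw [tsum_zero] at hz
    exact hz

theorem exp_dich (θ₀ ε : ℝ) (hε : 0 < ε) (P : ℝ → Prop)
    (hP : ∀ θ : ℝ, ‖Complex.exp (θ * Complex.I) - Complex.exp (θ₀ * Complex.I)‖ < ε → P θ)
    (z : ℂ) (hz : z ∈ ball (Complex.exp (θ₀ * Complex.I)) (ε / 2)) (θ : ℝ) :
    P θ ∨ (Complex.exp (θ * Complex.I) - z ≠ 0 ∧ ε / 2 ≤ ‖Complex.exp (θ * Complex.I) - z‖) := by
  by_cases h : ‖Complex.exp (θ * Complex.I) - Complex.exp (θ₀ * Complex.I)‖ < ε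
  · exact Or.inl (hP θ h)
  · right
    have h1 : ε / 2 ≤ ‖Complex.exp (θ * Complex.I) - z‖ := by
      rw [mem_ball, dist_eq_norm] at hz
      have h2 := norm_add_le (Complex.exp (θ * Complex.I) - z) (z - Complex.exp (θ₀ * Complex.I))
      rw [sub_add_sub_cancel] at h2
      push Not at h
      linarith
    refine ⟨fun h0 => ?_, h1⟩
    rw [h0, norm_zero] at h1
    linarith

theorem exp_hasDeriv (θ : ℝ) :
    HasDerivAt (fun t : ℝ => Complex.exp (t * Complex.I)) (Complex.exp (θ * Complex.I) * Complex.I) θ := by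
  have h : HasDerivAt (fun t : ℝ => (t : ℂ) * Complex.I) Complex.I θ := by
    simpa using (Complex.ofRealCLM.hasDerivAt (x := θ)).mul_const Complex.I
  exact h.cexp

theorem q_hasDeriv (z : ℂ) (θ : ℝ) (h : Complex.exp (θ * Complex.I) - z ≠ 0) :
    HasDerivAt (fun t : ℝ => Complex.exp (t * Complex.I) / (Complex.exp (t * Complex.I) - z))
      (Complex.I * (Complex.exp (θ * Complex.I) / (Complex.exp (θ * Complex.I) - z)
        - (Complex.exp (θ * Complex.I) / (Complex.exp (θ * Complex.I) - z)) ^ 2)) θ := by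
  have h1 := (exp_hasDeriv θ).div ((exp_hasDeriv θ).sub_const z) h
  refine h1.congr_deriv ?_
  generalize Complex.exp (θ * Complex.I) = E at h
  field_simp

theorem kernel_bound (θ₀ ε : ℝ) (hε : 0 < ε) (ψ ψ1 ψ2 : ℝ → ℂ)
    (h1 : ∀ θ, HasDerivAt ψ (ψ1 θ) θ) (h2 : ∀ θ, HasDerivAt ψ1 (ψ2 θ) θ) (hc : Continuous ψ2)
    (hp : ∀ θ, ψ (θ + 2 * Real.pi) = ψ θ) (hp1 : ∀ θ, ψ1 (θ + 2 * Real.pi) = ψ1 θ)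
    (hv : ∀ θ : ℝ, ‖Complex.exp (θ * Complex.I) - Complex.exp (θ₀ * Complex.I)‖ < ε →
      ∀ᶠ t in nhds θ, ψ t = 0 ∧ ψ1 t = 0 ∧ ψ2 t = 0) :
    ∃ K : ℝ, ∀ z ∈ ball (Complex.exp (θ₀ * Complex.I)) (ε / 2), ∀ m : ℤ,
      ‖∫ θ in (θ₀ - Real.pi)..(θ₀ + Real.pi),
        ψ θ * (Complex.exp (θ * Complex.I) / (Complex.exp (θ * Complex.I) - z)) *
          Complex.exp (m * θ * Complex.I)‖ ≤ K * (1 + (m:ℝ)^2)⁻¹ := by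
  have hψc : Continuous ψ := continuous_iff_continuousAt.2 fun θ => (h1 θ).continuousAt
  have hψc1 : Continuous ψ1 := continuous_iff_continuousAt.2 fun θ => (h2 θ).continuousAt
  obtain ⟨A0, hA0⟩ := (isCompact_Icc (a := θ₀ - Real.pi) (b := θ₀ + Real.pi)).exists_bound_of_continuousOn hψc.continuousOn
  obtain ⟨A1, hA1⟩ := (isCompact_Icc (a := θ₀ - Real.pi) (b := θ₀ + Real.pi)).exists_bound_of_continuousOn hψc1.continuousOn
  obtain ⟨A2, hA2⟩ := (isCompact_Icc (a := θ₀ - Real.pi) (b := θ₀ + Real.pi)).exists_bound_of_continuousOn hc.continuousOn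
  have hmem : θ₀ ∈ Icc (θ₀ - Real.pi) (θ₀ + Real.pi) := by
    constructor <;> linarith [Real.pi_pos]
  have p0 := (norm_nonneg _).trans (hA0 _ hmem)
  have p1 := (norm_nonneg _).trans (hA1 _ hmem)
  have p2 := (norm_nonneg _).trans (hA2 _ hmem)
  set Q : ℝ := 2 / ε with hQ
  have hQ0 : 0 < Q := by positivity
  set K : ℝ := A0 * Q + (A2 * Q + 2 * (A1 * (Q + Q ^ 2)) + A0 * ((1 + 2 * Q) * (Q + Q ^ 2))) with hK
  refine ⟨4 * Real.pi * K, fun z hz m => ?_⟩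
  set q : ℝ → ℂ := fun θ => Complex.exp (θ * Complex.I) / (Complex.exp (θ * Complex.I) - z) with hq
  set q1 : ℝ → ℂ := fun θ => Complex.I * (q θ - q θ ^ 2) with hq1
  set q2 : ℝ → ℂ := fun θ => Complex.I * (q1 θ - 2 * q θ * q1 θ) with hq2
  have hdich := exp_dich θ₀ ε hε _ hv z hz
  have hqd : ∀ θ : ℝ, Complex.exp (θ * Complex.I) - z ≠ 0 → HasDerivAt q (q1 θ) θ :=
    fun θ h => q_hasDeriv z θ h
  have hq1d : ∀ θ : ℝ, Complex.exp (θ * Complex.I) - z ≠ 0 → HasDerivAt q1 (q2 θ) θ := by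
    intro θ h
    have h3 := ((hqd θ h).sub ((hqd θ h).pow 2)).const_mul Complex.I
    refine h3.congr_deriv ?_
    simp only [hq2]
    push_cast
    ring
  have hqb : ∀ θ : ℝ, ε / 2 ≤ ‖Complex.exp (θ * Complex.I) - z‖ → ‖q θ‖ ≤ Q := by
    intro θ h
    simp only [hq]
    rw [norm_div, Complex.norm_exp_ofReal_mul_I, hQ]
    rw [div_le_div_iff₀ (by linarith) hε]
    linarith
  have hper : ∀ θ, q (θ + 2 * Real.pi) = q θ := by
    intro θ
    have : Complex.exp (((θ + 2 * Real.pi : ℝ) : ℂ) * Complex.I) = Complex.exp (θ * Complex.I) := by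
      push_cast
      rw [add_mul]
      exact Complex.exp_periodic _
    simp only [hq]
    rw [this]
  have hq1b : ∀ θ : ℝ, ‖q θ‖ ≤ Q → ‖q1 θ‖ ≤ Q + Q ^ 2 := by
    intro θ h
    simp only [hq1]
    rw [norm_mul, Complex.norm_I, one_mul]
    refine (norm_sub_le _ _).trans ?_
    rw [norm_pow]
    gcongr
  have hq2b : ∀ θ : ℝ, ‖q θ‖ ≤ Q → ‖q2 θ‖ ≤ (1 + 2 * Q) * (Q + Q ^ 2) := by
    intro θ h
    have e : q2 θ = Complex.I * ((1 - 2 * q θ) * q1 θ) := by simp only [hq2]; ring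
    rw [e, norm_mul, Complex.norm_I, one_mul, norm_mul]
    refine mul_le_mul ?_ (hq1b θ h) (norm_nonneg _) (by positivity)
    refine (norm_sub_le _ _).trans ?_
    rw [norm_one, norm_mul, Complex.norm_two]
    linarith
  have hyx : θ₀ + Real.pi = (θ₀ - Real.pi) + 2 * Real.pi := by ring
  refine fourier_bound (fun θ => ψ θ * q θ) (fun θ => ψ1 θ * q θ + ψ θ * q1 θ)
    (fun θ => ψ2 θ * q θ + 2 * (ψ1 θ * q1 θ) + ψ θ * q2 θ) _ _ ?_ ?_ ?_ hyx ?_ ?_ K ?_ ?_ m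
  · intro θ
    rcases hdich θ with h | ⟨h, -⟩
    · have e := h.self_of_nhds
      have : HasDerivAt (fun θ => ψ θ * q θ) 0 θ :=
        (hasDerivAt_const θ (0:ℂ)).congr_of_eventuallyEq (h.mono fun t ht => by simp [ht.1])
      refine this.congr_deriv ?_
      simp [e.1, e.2.1]
    · exact (h1 θ).mul (hqd θ h)
  · intro θ
    rcases hdich θ with h | ⟨h, -⟩
    · have e := h.self_of_nhds
      have : HasDerivAt (fun θ => ψ1 θ * q θ + ψ θ * q1 θ) 0 θ :=
        (hasDerivAt_const θ (0:ℂ)).congr_of_eventuallyEq (h.mono fun t ht => by simp [ht.1, ht.2.1])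
      refine this.congr_deriv ?_
      simp [e.1, e.2.1, e.2.2]
    · refine (((h2 θ).mul (hqd θ h)).add ((h1 θ).mul (hq1d θ h))).congr_deriv ?_
      ring
  · rw [continuous_iff_continuousAt]
    intro θ
    rcases hdich θ with h | ⟨h, -⟩
    · exact (continuousAt_const (y := (0:ℂ))).congr (h.mono fun t ht => by simp [ht.1, ht.2.1, ht.2.2])
    · have c1 := (hqd θ h).continuousAt
      have c2 := (hq1d θ h).continuousAt
      have c3 : ContinuousAt q2 θ := by
        simp only [hq2]
        fun_prop
      have c4 := hc.continuousAt (x := θ)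
      have c5 := hψc.continuousAt (x := θ)
      have c6 := hψc1.continuousAt (x := θ)
      fun_prop
  · simp only [hyx]
    rw [hp, hper]
  · have : ∀ θ, q1 (θ + 2 * Real.pi) = q1 θ := fun θ => by simp only [hq1]; rw [hper]
    simp only [hyx]
    rw [hp, hper, hp1, this]
  · intro θ hθ
    have hnn : 0 ≤ (A2 * Q + 2 * (A1 * (Q + Q ^ 2)) + A0 * ((1 + 2 * Q) * (Q + Q ^ 2))) := by positivity
    have hnn2 : 0 ≤ A0 * Q := by positivity
    rcases hdich θ with h | ⟨-, h⟩
    · have e := h.self_of_nhds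
      simp only [e.1, zero_mul, norm_zero]
      linarith
    · rw [norm_mul]
      have := mul_le_mul (hA0 θ hθ) (hqb θ h) (norm_nonneg _) p0
      linarith
  · intro θ hθ
    have hnn : 0 ≤ (A2 * Q + 2 * (A1 * (Q + Q ^ 2)) + A0 * ((1 + 2 * Q) * (Q + Q ^ 2))) := by positivity
    have hnn2 : 0 ≤ A0 * Q := by positivity
    rcases hdich θ with h | ⟨-, h⟩
    · have e := h.self_of_nhds
      simp only [e.1, e.2.1, e.2.2, zero_mul, add_zero, mul_zero, norm_zero]
      linarith
    · have b0 := hqb θ h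
      have b1 := hq1b θ b0
      have b2 := hq2b θ b0
      have t0 := mul_le_mul (hA2 θ hθ) b0 (norm_nonneg _) p2
      have t1 := mul_le_mul (hA1 θ hθ) b1 (norm_nonneg _) p1
      have t2 := mul_le_mul (hA0 θ hθ) b2 (norm_nonneg _) p0
      refine (norm_add₃_le).trans ?_
      simp only [norm_mul, Complex.norm_two]
      linarith

theorem kernel_cont (θ₀ ε : ℝ) (hε : 0 < ε) (ψ : ℝ → ℂ) (hψc : Continuous ψ)
    (hv : ∀ θ : ℝ, ‖Complex.exp (θ * Complex.I) - Complex.exp (θ₀ * Complex.I)‖ < ε →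
      ∀ᶠ t in nhds θ, ψ t = 0) (m : ℤ) (k : ℕ)
    (z : ℂ) (hz : z ∈ ball (Complex.exp (θ₀ * Complex.I)) (ε / 2)) :
    Continuous fun θ : ℝ => ψ θ * (Complex.exp (θ * Complex.I) / (Complex.exp (θ * Complex.I) - z) ^ k) *
          Complex.exp (m * θ * Complex.I) := by
  rw [continuous_iff_continuousAt]
  intro θ
  rcases exp_dich θ₀ ε hε _ hv z hz θ with h | ⟨h, -⟩
  · exact (continuousAt_const (y := (0:ℂ))).congr (h.mono fun t ht => by simp [ht])
  · refine (hψc.continuousAt.mul (ContinuousAt.div ?_ ?_ (pow_ne_zero k h))).mul ?_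
    all_goals fun_prop

theorem kernel_diff (θ₀ ε : ℝ) (hε : 0 < ε) (ψ : ℝ → ℂ) (hψc : Continuous ψ)
    (hv : ∀ θ : ℝ, ‖Complex.exp (θ * Complex.I) - Complex.exp (θ₀ * Complex.I)‖ < ε →
      ∀ᶠ t in nhds θ, ψ t = 0) (m : ℤ) :
    DifferentiableOn ℂ (fun z : ℂ => ∫ θ in (θ₀ - Real.pi)..(θ₀ + Real.pi),
        ψ θ * (Complex.exp (θ * Complex.I) / (Complex.exp (θ * Complex.I) - z)) *
          Complex.exp (m * θ * Complex.I)) (ball (Complex.exp (θ₀ * Complex.I)) (ε / 2)) := by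
  intro z hz
  have hle : θ₀ - Real.pi ≤ θ₀ + Real.pi := by linarith [Real.pi_pos]
  obtain ⟨A0, hA0⟩ := (isCompact_Icc (a := θ₀ - Real.pi) (b := θ₀ + Real.pi)).exists_bound_of_continuousOn hψc.continuousOn
  have hA : ∀ θ ∈ Set.uIoc (θ₀ - Real.pi) (θ₀ + Real.pi), ‖ψ θ‖ ≤ A0 := by
    intro θ hθ
    rw [uIoc_of_le hle] at hθ
    exact hA0 θ ⟨hθ.1.le, hθ.2⟩
  have hc1 : ∀ w ∈ ball (Complex.exp (θ₀ * Complex.I)) (ε / 2), Continuous fun θ : ℝ =>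
      ψ θ * (Complex.exp (θ * Complex.I) / (Complex.exp (θ * Complex.I) - w)) *
          Complex.exp (m * θ * Complex.I) := by
    intro w hw
    have := kernel_cont θ₀ ε hε ψ hψc hv m 1 w hw
    simpa only [pow_one] using this
  have hnhds : ball (Complex.exp (θ₀ * Complex.I)) (ε / 2) ∈ nhds z := isOpen_ball.mem_nhds hz
  have key := intervalIntegral.hasDerivAt_integral_of_dominated_loc_of_deriv_le
    (μ := volume) (a := θ₀ - Real.pi) (b := θ₀ + Real.pi) (x₀ := z)
    (F := fun z θ => ψ θ * (Complex.exp (θ * Complex.I) / (Complex.exp (θ * Complex.I) - z)) *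
          Complex.exp (m * θ * Complex.I))
    (F' := fun z θ => ψ θ * (Complex.exp (θ * Complex.I) / (Complex.exp (θ * Complex.I) - z) ^ 2) *
          Complex.exp (m * θ * Complex.I))
    (bound := fun _ => A0 * (1 / (ε / 2) ^ 2)) hnhds
    (eventually_of_mem hnhds fun w hw => (hc1 w hw).aestronglyMeasurable)
    ((hc1 z hz).intervalIntegrable _ _)
    (kernel_cont θ₀ ε hε ψ hψc hv m 2 z hz).aestronglyMeasurable
    (Eventually.of_forall fun θ hθ w hw => ?_)
    intervalIntegrable_const
    (Eventually.of_forall fun θ hθ w hw => ?_)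
  · exact key.2.differentiableAt.differentiableWithinAt
  · rw [norm_mul, exp_int_norm, mul_one]
    have hA00 := (norm_nonneg _).trans (hA θ hθ)
    rcases exp_dich θ₀ ε hε _ hv w hw θ with h | ⟨-, h⟩
    · rw [h.self_of_nhds, zero_mul, norm_zero]
      positivity
    · rw [norm_mul]
      refine mul_le_mul (hA θ hθ) ?_ (norm_nonneg _) hA00
      rw [norm_div, Complex.norm_exp_ofReal_mul_I, norm_pow]
      gcongr
  · rcases exp_dich θ₀ ε hε _ hv w hw θ with h | ⟨h, -⟩
    · simp only [h.self_of_nhds, zero_mul]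
      exact hasDerivAt_const _ _
    · have h3 := ((hasDerivAt_const w (Complex.exp (θ * Complex.I))).div
        ((hasDerivAt_const w (Complex.exp (θ * Complex.I))).sub (hasDerivAt_id w)) h)
      have h4 := (h3.const_mul (ψ θ)).mul_const (Complex.exp (m * θ * Complex.I))
      refine h4.congr_deriv ?_
      simp

theorem summable_shift (g : ℤ → ℝ) (hg : Summable g) (l : ℤ) : Summable fun m => g (m - l) :=
  (Equiv.subRight l).summable_iff.2 hg

theorem int_exp_period (θ₀ : ℝ) (m : ℤ) :
    ∫ θ in (θ₀ - Real.pi)..(θ₀ + Real.pi), Complex.exp (m * θ * Complex.I)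
      = if m = 0 then 2 * Real.pi else 0 := by
  split_ifs with h
  · subst h
    simp
    ring
  · have hm : (m : ℂ) * Complex.I ≠ 0 := mul_ne_zero (by exact_mod_cast h) Complex.I_ne_zero
    have e : ∀ θ : ℝ, Complex.exp (m * θ * Complex.I) = Complex.exp ((m * Complex.I) * θ) := by
      intro θ
      congr 1
      ring
    simp_rw [e]
    rw [integral_exp_mul_complex hm]
    have : Complex.exp (m * Complex.I * ((θ₀ + Real.pi : ℝ) : ℂ))
        = Complex.exp (m * Complex.I * ((θ₀ - Real.pi : ℝ) : ℂ)) := by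
      rw [Complex.exp_eq_exp_iff_exists_int]
      refine ⟨m, ?_⟩
      push_cast
      ring
    rw [this, sub_self, zero_div, Complex.ofReal_zero]

theorem local_cont (θ₀ ε : ℝ) (hε : 0 < ε) (ψ ψ1 ψ2 : ℝ → ℂ)
    (h1 : ∀ θ, HasDerivAt ψ (ψ1 θ) θ) (h2 : ∀ θ, HasDerivAt ψ1 (ψ2 θ) θ) (hc : Continuous ψ2)
    (hp : ∀ θ, ψ (θ + 2 * Real.pi) = ψ θ) (hp1 : ∀ θ, ψ1 (θ + 2 * Real.pi) = ψ1 θ)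
    (hv : ∀ θ : ℝ, ‖Complex.exp (θ * Complex.I) - Complex.exp (θ₀ * Complex.I)‖ < ε →
      ∀ᶠ t in nhds θ, ψ t = 0 ∧ ψ1 t = 0 ∧ ψ2 t = 0)
    (b : ℤ → ℂ) (C : ℝ) (hb : ∀ m, ‖b m‖ ≤ C)
    (Φ : ℤ → ℂ) (hΦ : ∀ m : ℤ, Φ m = ∫ θ in (θ₀ - Real.pi)..(θ₀ + Real.pi),
      (1 - ψ θ) * Complex.exp (m * θ * Complex.I))
    (B : ℝ) (hB : ∀ m : ℤ, ‖Φ m‖ ≤ B * (1 + (m:ℝ)^2)⁻¹)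
    (hvan : ∀ l, ∑' m : ℤ, b m * Φ (m + l) = 0) :
    ∃ G : ℂ → ℂ, DifferentiableOn ℂ G (ball (Complex.exp (θ₀ * Complex.I)) (ε / 2)) ∧
      ∀ z ∈ ball (Complex.exp (θ₀ * Complex.I)) (ε / 2),
        (‖z‖ < 1 → G z = fPlus b z) ∧ (1 < ‖z‖ → G z = - fMinus b z) := by
  have hψc : Continuous ψ := continuous_iff_continuousAt.2 fun θ => (h1 θ).continuousAt
  have hv0 : ∀ θ : ℝ, ‖Complex.exp (θ * Complex.I) - Complex.exp (θ₀ * Complex.I)‖ < ε →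
      ∀ᶠ t in nhds θ, ψ t = 0 := fun θ h => (hv θ h).mono fun t ht => ht.1
  have hC0 : 0 ≤ C := (norm_nonneg _).trans (hb 0)
  obtain ⟨K, hK⟩ := kernel_bound θ₀ ε hε ψ ψ1 ψ2 h1 h2 hc hp hp1 hv
  have hd := kernel_diff θ₀ ε hε ψ hψc hv0
  have hcc := kernel_cont θ₀ ε hε ψ hψc hv0
  set c : ℤ → ℂ → ℂ := fun m z => ∫ θ in (θ₀ - Real.pi)..(θ₀ + Real.pi),
        ψ θ * (Complex.exp (θ * Complex.I) / (Complex.exp (θ * Complex.I) - z)) *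
          Complex.exp (m * θ * Complex.I) with hcdef
  set U := ball (Complex.exp (θ₀ * Complex.I)) (ε / 2) with hU
  have hrec : ∀ z ∈ U, ∀ m : ℤ, c m z - z * c (m - 1) z = (if m = 0 then 2 * Real.pi else 0) - Φ m := by
    intro z hz m
    have i1 : c m z - z * c (m - 1) z = ∫ θ in (θ₀ - Real.pi)..(θ₀ + Real.pi),
        ψ θ * Complex.exp (m * θ * Complex.I) := by
      simp only [hcdef]
      rw [← intervalIntegral.integral_const_mul, ← intervalIntegral.integral_sub]
      · refine intervalIntegral.integral_congr fun θ _ => ?_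
        beta_reduce
        rcases exp_dich θ₀ ε hε _ hv0 z hz θ with h | ⟨h, -⟩
        · simp [h.self_of_nhds]
        · have e : Complex.exp (m * θ * Complex.I)
              = Complex.exp (((m - 1 : ℤ) : ℂ) * θ * Complex.I) * Complex.exp (θ * Complex.I) := by
            rw [← Complex.exp_add]
            congr 1
            push_cast
            ring
          rw [e]
          generalize Complex.exp (θ * Complex.I) = E at h
          field_simp
      · have := hcc m 1 z hz
        simp only [pow_one] at this
        exact this.intervalIntegrable _ _
      · have := hcc (m - 1) 1 z hz
        simp only [pow_one] at this
        exact (this.const_mul z).intervalIntegrable _ _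
    rw [i1, hΦ, ← int_exp_period θ₀ m, ← intervalIntegral.integral_sub]
    · refine intervalIntegral.integral_congr fun θ _ => ?_
      beta_reduce
      ring
    · exact Continuous.intervalIntegrable (by fun_prop) _ _
    · exact Continuous.intervalIntegrable (by fun_prop) _ _
  have hbd : ∀ z ∈ U, ∀ l m : ℤ, ‖b m * c (m - l) z‖ ≤ C * (K * (1 + ((m - l : ℤ):ℝ)^2)⁻¹) := by
    intro z hz l m
    rw [norm_mul]
    exact mul_le_mul (hb m) (hK z hz (m - l)) (norm_nonneg _) hC0
  have hs0 : Summable fun m : ℤ => C * (K * (1 + (m:ℝ)^2)⁻¹) :=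
    (summable_int_sq.mul_left K).mul_left C
  have hsl : ∀ l : ℤ, Summable fun m : ℤ => C * (K * (1 + ((m - l : ℤ):ℝ)^2)⁻¹) := fun l =>
    summable_shift _ hs0 l
  have htl : ∀ l : ℤ, ∑' m : ℤ, C * (K * (1 + ((m - l : ℤ):ℝ)^2)⁻¹) = ∑' m : ℤ, C * (K * (1 + (m:ℝ)^2)⁻¹) :=
    fun l => (Equiv.subRight l).tsum_eq (fun m : ℤ => C * (K * (1 + (m:ℝ)^2)⁻¹))
  have hsum : ∀ z ∈ U, ∀ l : ℤ, Summable fun m => b m * c (m - l) z := fun z hz l =>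
    Summable.of_norm_bounded (hsl l) (hbd z hz l)
  set S : ℤ → ℂ → ℂ := fun l z => (2 * Real.pi : ℂ)⁻¹ * ∑' m, b m * c (m - l) z with hS
  have hpi : (2 * Real.pi : ℂ) ≠ 0 := by
    exact_mod_cast (by positivity : (2 * Real.pi) ≠ 0)
  refine ⟨S 0, ?_, ?_⟩
  · refine DifferentiableOn.const_mul ?_ _
    refine Complex.differentiableOn_tsum_of_summable_norm (hsl 0) (fun m => ?_) isOpen_ball
      (fun m z hz => hbd z hz 0 m)
    exact (hd (m - 0)).const_mul (b m)
  · intro z hz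
    refine recur_sum b C hb (fun l => S l z)
      (‖(2 * Real.pi : ℂ)⁻¹‖ * ∑' m : ℤ, C * (K * (1 + (m:ℝ)^2)⁻¹)) (fun l => ?_) z (fun l => ?_)
    · simp only [hS]
      rw [norm_mul]
      refine mul_le_mul_of_nonneg_left ?_ (norm_nonneg _)
      rw [← htl l]
      exact tsum_of_norm_bounded (hsl l).hasSum (hbd z hz l)
    · have hΦs : Summable fun m => b m * Φ (m + (-l)) := by
        refine Summable.of_norm_bounded (g := fun m : ℤ => C * (B * (1 + ((m - l : ℤ):ℝ)^2)⁻¹)) ?_ ?_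
        · exact summable_shift _ ((summable_int_sq.mul_left B).mul_left C) l
        · intro m
          rw [norm_mul]
          exact mul_le_mul (hb m) (hB (m - l)) (norm_nonneg _) hC0
      have e1 : HasSum (fun m => b m * c (m - l) z - z * (b m * c (m - (l + 1)) z))
          ((∑' m, b m * c (m - l) z) - z * ∑' m, b m * c (m - (l + 1)) z) :=
        (hsum z hz l).hasSum.sub ((hsum z hz (l + 1)).hasSum.mul_left z)
      have e2 : HasSum (fun m => (if m = l then b l * (2 * Real.pi) else 0) - b m * Φ (m + (-l)))
          (b l * (2 * Real.pi) - 0) := by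
        refine HasSum.sub (hasSum_ite_eq l _) ?_
        have := hΦs.hasSum
        rwa [hvan] at this
      have e3 : (fun m => b m * c (m - l) z - z * (b m * c (m - (l + 1)) z))
          = (fun m => (if m = l then b l * (2 * Real.pi : ℂ) else 0) - b m * Φ (m + (-l))) := by
        funext m
        have := hrec z hz (m - l)
        rw [show m - l - 1 = m - (l + 1) by ring] at this
        have e4 : b m * c (m - l) z - z * (b m * c (m - (l + 1)) z)
            = b m * (c (m - l) z - z * c (m - (l + 1)) z) := by ring
        rw [e4, this, ← sub_eq_add_neg]
        by_cases h : m = l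
        · subst h
          simp
          ring
        · rw [if_neg h, if_neg (sub_ne_zero.2 h), Complex.ofReal_zero]
          ring
      rw [e3] at e1
      have e5 := e1.unique e2
      simp only [hS]
      rw [sub_zero, sub_eq_iff_eq_add] at e5
      rw [e5]
      field_simp

theorem right_limit_bound (a : ℕ → ℂ) (C : ℝ) (hC : ∀ n, ‖a n‖ ≤ C) (b : ℤ → ℂ)
    (hb : IsRightLimit a b) (m : ℤ) : ‖b m‖ ≤ C := by
  obtain ⟨n, -, h⟩ := hb
  exact le_of_tendsto (h m).norm (Eventually.of_forall fun j => hC _)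

theorem circle_cont (a : ℕ → ℂ) (C : ℝ) (hC : ∀ n, ‖a n‖ ≤ C)
    (f : ℂ → ℂ) (hf : ∀ z ∈ Metric.ball (0 : ℂ) 1, f z = ∑' n : ℕ, a n * z ^ n)
    (r : ℝ) (h0 : 0 < r) (h1 : r < 1) :
    Continuous fun θ : ℝ => f (r * Complex.exp (θ * Complex.I)) := by
  have hpos : ∀ θ : ℝ, ‖(r * Complex.exp (θ * Complex.I) : ℂ)‖ = r := by
    intro θ
    rw [norm_mul, Complex.norm_exp_ofReal_mul_I, Complex.norm_real, Real.norm_eq_abs, abs_of_pos h0, mul_one]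
  have hft : ∀ θ : ℝ, f (r * Complex.exp (θ * Complex.I))
      = ∑' i : ℕ, a i * (r * Complex.exp (θ * Complex.I)) ^ i := by
    intro θ
    exact hf _ (by rw [mem_ball_zero_iff, hpos θ]; exact h1)
  simp_rw [hft]
  refine continuous_tsum (u := fun i : ℕ => C * r ^ i) (fun i => by fun_prop)
    ((summable_geometric_of_lt_one h0.le h1).mul_left C) (fun i θ => ?_)
  rw [norm_mul, norm_pow, hpos θ]
  exact mul_le_mul_of_nonneg_right (hC i) (by positivity)

theorem local_exists (a : ℕ → ℂ) (C : ℝ) (hC : ∀ n, ‖a n‖ ≤ C)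
    (f : ℂ → ℂ) (hf : ∀ z ∈ Metric.ball (0 : ℂ) 1, f z = ∑' n : ℕ, a n * z ^ n)
    (α β : ℝ) (M : ℝ) (hsup : ∀ r : ℝ, 0 < r → r < 1 →
      (∫ θ in α..β, ‖f (r * Complex.exp (θ * Complex.I))‖) / (2 * Real.pi) ≤ M)
    (b : ℤ → ℂ) (hb : IsRightLimit a b) (θ₀ : ℝ) (hθ : θ₀ ∈ Ioo α β) :
    ∃ δ > (0 : ℝ), ∃ G : ℂ → ℂ, DifferentiableOn ℂ G (ball (Complex.exp (θ₀ * Complex.I)) δ) ∧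
      ∀ z ∈ ball (Complex.exp (θ₀ * Complex.I)) δ,
        (‖z‖ < 1 → G z = fPlus b z) ∧ (1 < ‖z‖ → G z = - fMinus b z) := by
  have hpi := Real.pi_pos
  obtain ⟨η, hη, hηπ, hηα, hηβ⟩ : ∃ η : ℝ, 0 < η ∧ η < Real.pi ∧ α ≤ θ₀ - η ∧ θ₀ + η ≤ β := by
    refine ⟨min (Real.pi / 2) (min (θ₀ - α) (β - θ₀)), ?_, ?_, ?_, ?_⟩
    · exact lt_min (by positivity) (lt_min (by linarith [hθ.1]) (by linarith [hθ.2]))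
    · exact (min_le_left _ _).trans_lt (by linarith)
    · have := (min_le_right (Real.pi / 2) (min (θ₀ - α) (β - θ₀))).trans (min_le_left _ _)
      linarith
    · have := (min_le_right (Real.pi / 2) (min (θ₀ - α) (β - θ₀))).trans (min_le_right _ _)
      linarith
  obtain ⟨ψ, ψ1, ψ2, ε, hε, h1, h2, hc, hp, hp1, hv, hψ1, hψb⟩ := bump_exists θ₀ η hη hηπ
  have hψc : Continuous ψ := continuous_iff_continuousAt.2 fun θ => (h1 θ).continuousAt
  obtain ⟨A2, hA2⟩ := (isCompact_Icc (a := θ₀ - Real.pi) (b := θ₀ + Real.pi)).exists_bound_of_continuousOn hc.continuousOn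
  have hyx : θ₀ + Real.pi = (θ₀ - Real.pi) + 2 * Real.pi := by ring
  have hB : ∀ m : ℤ, ‖∫ θ in (θ₀ - Real.pi)..(θ₀ + Real.pi), (1 - ψ θ) * Complex.exp (m * θ * Complex.I)‖
      ≤ 4 * Real.pi * max 1 A2 * (1 + (m:ℝ)^2)⁻¹ := by
    refine fourier_bound (fun θ => 1 - ψ θ) (fun θ => - ψ1 θ) (fun θ => - ψ2 θ) _ _
      (fun θ => (h1 θ).const_sub 1) (fun θ => (h2 θ).neg) hc.neg hyx ?_ ?_ _ ?_ ?_
    · simp only [hyx, hp]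
    · simp only [hyx, hp1]
    · intro θ _
      exact (hψb θ).trans (le_max_left _ _)
    · intro θ h
      rw [norm_neg]
      exact (hA2 θ h).trans (le_max_right _ _)
  have hK : ∀ r : ℝ, 0 < r → r < 1 →
      ∫ θ in (θ₀ - η)..(θ₀ + η), ‖f (r * Complex.exp (θ * Complex.I))‖ ≤ M * (2 * Real.pi) := by
    intro r h0 h1
    have hcont := (circle_cont a C hC f hf r h0 h1).norm
    refine le_trans ?_ ((div_le_iff₀ (by positivity)).1 (hsup r h0 h1))
    exact intervalIntegral.integral_mono_interval hηα (by linarith) hηβ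
      (Eventually.of_forall fun θ => norm_nonneg _) (hcont.intervalIntegrable _ _)
  have hvan := vanish_pair a C hC f hf θ₀ η (M * (2 * Real.pi)) hη hηπ hK (fun θ => 1 - ψ θ)
    (by fun_prop) hψb (fun θ h h' => by rw [hψ1 θ h h', sub_self])
    (fun m => ∫ θ in (θ₀ - Real.pi)..(θ₀ + Real.pi), (1 - ψ θ) * Complex.exp (m * θ * Complex.I))
    (fun m => rfl) (4 * Real.pi * max 1 A2) hB b hb
  obtain ⟨G, hG⟩ := local_cont θ₀ ε hε ψ ψ1 ψ2 h1 h2 hc hp hp1 hv b C (right_limit_bound a C hC b hb)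
    (fun m => ∫ θ in (θ₀ - Real.pi)..(θ₀ + Real.pi), (1 - ψ θ) * Complex.exp (m * θ * Complex.I))
    (fun m => rfl) (4 * Real.pi * max 1 A2) hB hvan
  exact ⟨ε / 2, by positivity, G, hG⟩

theorem fPlus_diff (b : ℤ → ℂ) (C : ℝ) (hb : ∀ m, ‖b m‖ ≤ C) (z : ℂ) (hz : ‖z‖ < 1) :
    DifferentiableAt ℂ (fPlus b) z := by
  obtain ⟨r, hr1, hr2⟩ := exists_between hz
  have hr0 : 0 ≤ r := (norm_nonneg _).trans hr1.le
  have h : DifferentiableOn ℂ (fPlus b) (ball (0:ℂ) r) := by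
    refine Complex.differentiableOn_tsum_of_summable_norm (u := fun i : ℕ => C * r ^ i)
      ((summable_geometric_of_lt_one hr0 hr2).mul_left C) (fun i => by fun_prop) isOpen_ball
      (fun i w hw => ?_)
    rw [mem_ball_zero_iff] at hw
    rw [norm_mul, norm_pow]
    exact mul_le_mul (hb _) (pow_le_pow_left₀ (norm_nonneg _) hw.le _) (by positivity)
      ((norm_nonneg _).trans (hb 0))
  exact h.differentiableAt (isOpen_ball.mem_nhds (by rwa [mem_ball_zero_iff]))

theorem fMinus_diff (b : ℤ → ℂ) (C : ℝ) (hb : ∀ m, ‖b m‖ ≤ C) (z : ℂ) (hz : 1 < ‖z‖) :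
    DifferentiableAt ℂ (fMinus b) z := by
  have hz0 : z ≠ 0 := fun h => by rw [h, norm_zero] at hz; linarith
  have e : ∀ w : ℂ, fMinus b w = w⁻¹ * fPlus (fun m => b (- m - 1)) w⁻¹ := by
    intro w
    simp only [fMinus, fPlus]
    rw [← tsum_mul_left]
    refine tsum_congr fun n => ?_
    have : w ^ (-(n:ℤ) - 1) = (w⁻¹) ^ (n + 1) := by
      rw [← zpow_natCast, inv_zpow']
      congr 1
      push_cast
      ring
    rw [this, pow_succ]
    ring
  have h1 : DifferentiableAt ℂ (fun w : ℂ => w⁻¹) z := differentiableAt_inv hz0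
  have h2 := fPlus_diff (fun m => b (- m - 1)) C (fun m => hb _) z⁻¹
    (by rw [norm_inv]; exact inv_lt_one_of_one_lt₀ hz)
  have h3 : DifferentiableAt ℂ (fun w => w⁻¹ * fPlus (fun m => b (- m - 1)) w⁻¹) z :=
    h1.mul (DifferentiableAt.comp z h2 h1)
  exact h3.congr_of_eventuallyEq (Eventually.of_forall e)

theorem stmt1 (a : ℕ → ℂ) (C : ℝ) (hC : ∀ n, ‖a n‖ ≤ C)
    (f : ℂ → ℂ) (hf : ∀ z ∈ Metric.ball (0 : ℂ) 1, f z = ∑' n : ℕ, a n * z ^ n)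
    (α β : ℝ) (hαβ : α < β)
    (hsup : ∃ M : ℝ, ∀ r : ℝ, 0 < r → r < 1 →
      (∫ θ in α..β, ‖f (r * Complex.exp (θ * Complex.I))‖) / (2 * Real.pi) ≤ M) :
    ∀ b : ℤ → ℂ, IsRightLimit a b → Reflectionless b (arc α β) := by
  intro b hb
  obtain ⟨M, hM⟩ := hsup
  have hbC := right_limit_bound a C hC b hb
  set g : ℂ → ℂ := fun z => if ‖z‖ < 1 then fPlus b z else if 1 < ‖z‖ then - fMinus b z
    else limUnder (nhdsWithin z (ball (0:ℂ) 1)) (fPlus b) with hg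
  have g1 : ∀ z : ℂ, ‖z‖ < 1 → g z = fPlus b z := fun z hz => by simp only [hg]; rw [if_pos hz]
  have g2 : ∀ z : ℂ, 1 < ‖z‖ → g z = - fMinus b z := fun z hz => by
    simp only [hg]; rw [if_neg (by linarith), if_pos hz]
  refine ⟨g, ?_, fun z hz => g1 z (by rwa [mem_ball_zero_iff] at hz), g2⟩
  intro z hz
  refine DifferentiableAt.differentiableWithinAt ?_
  rcases lt_trichotomy ‖z‖ 1 with h | h | h
  · refine (fPlus_diff b C hbC z h).congr_of_eventuallyEq ?_
    filter_upwards [(isOpen_lt continuous_norm continuous_const).mem_nhds h] with w hw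
    exact g1 w hw
  · have hzI : z ∈ arc α β := by
      by_contra hn
      exact hz ⟨by rw [mem_sphere_zero_iff_norm]; exact h, hn⟩
    obtain ⟨θ₀, hθ, rfl⟩ := hzI
    obtain ⟨δ, hδ, G, hGd, hG⟩ := local_exists a C hC f hf α β M hM b hb θ₀ hθ
    have hm : Complex.exp (θ₀ * Complex.I) ∈ ball (Complex.exp (θ₀ * Complex.I)) δ := mem_ball_self hδ
    refine (hGd.differentiableAt (isOpen_ball.mem_nhds hm)).congr_of_eventuallyEq ?_
    filter_upwards [isOpen_ball.mem_nhds hm] with w hw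
    rcases lt_trichotomy ‖w‖ 1 with h' | h' | h'
    · rw [g1 w h', (hG w hw).1 h']
    · simp only [hg]
      rw [if_neg (by linarith), if_neg (by linarith)]
      have hne : (nhdsWithin w (ball (0:ℂ) 1)).NeBot := by
        rw [← mem_closure_iff_nhdsWithin_neBot, closure_ball _ one_ne_zero, mem_closedBall_zero_iff]
        exact h'.le
      refine Tendsto.limUnder_eq ?_
      have hcont : Tendsto G (nhdsWithin w (ball (0:ℂ) 1)) (nhds (G w)) :=
        ((hGd.differentiableAt (isOpen_ball.mem_nhds hw)).continuousAt.tendsto).mono_left nhdsWithin_le_nhds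
      refine hcont.congr' ?_
      filter_upwards [self_mem_nhdsWithin, mem_nhdsWithin_of_mem_nhds (isOpen_ball.mem_nhds hw)] with v hv1 hv2
      exact (hG v hv2).1 (by rwa [mem_ball_zero_iff] at hv1)
    · rw [g2 w h', (hG w hw).2 h']
  · refine (fMinus_diff b C hbC z h).neg.congr_of_eventuallyEq ?_
    filter_upwards [(isOpen_lt continuous_const continuous_norm).mem_nhds h] with w hw
    exact g2 w hw
end
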